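/- arXiv:2407.09272 — 2 statements merged into one kernel-verified Lean document; each statement's English description precedes it below -/
import Mathlib

section
/- Let F be the free group on a set S and let w ∈ F be a nontrivial positive word (i.e. w lies in the submonoid generated by the generators S, with no inverse generators). Then the one-relator group G = F/⟪w⟫ has a normal subgroup N that is a free group with G/N solvable, and consequently G is residually solvable, i.e. the intersection of the derived series ⋂_{i≥0} G^{(i)} is trivial. -/
/-- Every nonempty finite subset `D` of the group admits a rank function on the group which is
smallest at `1` and for which, given `q`, there is `i ∈ D` such that `q` is the unique element of
least rank among the elements `l⁻¹ * i * q` with `l ∈ D`. -/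
def ExtremallyRanked (Q : Type) [Group Q] : Prop :=
  ∀ D : Finset Q, D.Nonempty → ∃ ρ : Q → Ordinal.{0},
    (∀ q, q ≠ 1 → ρ 1 < ρ q) ∧ ∀ q, ∃ i ∈ D, ∀ l ∈ D, l ≠ i → ρ q < ρ (l⁻¹ * i * q)

namespace ExtremallyRanked

theorem of_injective {A B : Type} [Group A] [Group B] (hB : ExtremallyRanked B) (f : A →* B)
    (hf : Function.Injective f) : ExtremallyRanked A := by
  classical
  intro D hD
  obtain ⟨ρ, hone, hρ⟩ := hB (D.image f) (hD.image f)
  refine ⟨fun a => ρ (f a), fun q hq => ?_, fun q => ?_⟩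
  · simpa using hone (f q) (by simpa using (map_ne_one_iff f hf).2 hq)
  · obtain ⟨i, hi, h⟩ := hρ (f q)
    obtain ⟨i, hiD, rfl⟩ := Finset.mem_image.1 hi
    exact ⟨i, hiD, fun l hl hne => by
      simpa using h (f l) (Finset.mem_image_of_mem f hl) (hf.ne hne)⟩

theorem of_ker {Q B : Type} [Group Q] [Group B] (f : Q →* B) (hB : ExtremallyRanked B)
    (hK : ExtremallyRanked f.ker) : ExtremallyRanked Q := by
  classical
  intro D hD
  obtain ⟨ρB, hone, hρB⟩ := hB (D.image f) (hD.image f)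
  choose top htop hρB using hρB
  have hd : ∀ b, ∃ d ∈ D, f d = top b := fun b => Finset.mem_image.1 (htop b)
  choose d hdD hd using hd
  have hc : ∃ c : B → Q, c 1 = 1 ∧ ∀ q, f (c (f q)) = f q := by
    refine ⟨fun b => if b = 1 then 1 else if h : ∃ q, f q = b then h.choose else 1, by simp, ?_⟩
    intro q
    by_cases h1 : f q = 1
    · simp [h1]
    · have h : ∃ q', f q' = f q := ⟨q, rfl⟩
      simp only [h1, if_false, dif_pos h]
      exact h.choose_spec
  obtain ⟨c, hc1, hc⟩ := hc
  let E : B → Finset f.ker := fun b => (D.image fun x => (d b)⁻¹ * x).subtype (· ∈ f.ker)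
  have hE : ∀ b (k : f.ker), k ∈ E b ↔ d b * k ∈ D := by
    intro b k
    simp only [E, Finset.mem_subtype, Finset.mem_image]
    exact ⟨by rintro ⟨x, hx, h⟩; rwa [← h, mul_inv_cancel_left], fun h => ⟨_, h, by simp⟩⟩
  have hEne : ∀ b, (E b).Nonempty := fun b => ⟨1, (hE b 1).2 (by simpa using hdD b)⟩
  choose ρK honeK hρK using fun b => hK (E b) (hEne b)
  let κ : Q → f.ker := fun q => ⟨q * (c (f q))⁻¹, by simp [MonoidHom.mem_ker, hc]⟩
  let R : Q → Q → Prop := InvImage (Prod.Lex (· < ·) (· < ·))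
    fun q => (ρB (f q), ρK (f q) (κ q))
  have hR : WellFounded R := InvImage.wf _ (WellFounded.prod_lex Ordinal.lt_wf Ordinal.lt_wf)
  have : IsWellFounded Q R := ⟨hR⟩
  refine ⟨IsWellFounded.rank R, fun q hq => IsWellFounded.rank_lt_of_rel ?_, fun q => ?_⟩
  · by_cases h1 : f q = 1
    · simp only [R, InvImage, map_one, h1]
      apply Prod.Lex.right
      have : κ 1 = 1 := by ext; simp [κ, hc1]
      rw [this]
      apply honeK
      intro h
      apply hq
      have := congrArg Subtype.val h
      simpa [κ, h1, hc1] using this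
    · apply Prod.Lex.left
      rw [map_one]
      exact hone _ h1
  · obtain ⟨i, hi, hmax⟩ := hρK (f q) (κ q)
    refine ⟨d (f q) * i, (hE _ _).1 hi, fun l hl hne =>
      IsWellFounded.rank_lt_of_rel ?_⟩
    have hi1 : f (i : Q) = 1 := i.2
    by_cases hft : f l = top (f q)
    · have hmem : (d (f q))⁻¹ * l ∈ f.ker := by
        rw [MonoidHom.mem_ker, map_mul, map_inv, hd, hft, inv_mul_cancel]
      have hfe : f (l⁻¹ * (d (f q) * i) * q) = f q := by
        simp [hft, hd, hi1]
      simp only [R, InvImage, hfe]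
      apply Prod.Lex.right
      have := hmax ⟨_, hmem⟩ ((hE _ _).2 (by simpa using hl)) (by
        rintro rfl
        simp at hne)
      convert this using 2
      ext
      simp [κ, mul_assoc, hft, hd, hi1]
    · apply Prod.Lex.left
      have := hρB (f q) (f l) (Finset.mem_image_of_mem f hl) hft
      simpa [hd, hi1] using this

theorem of_module (V : Type) [AddCommGroup V] [Module ℚ V] :
    ExtremallyRanked (Multiplicative V) := by
  classical
  intro D hD
  obtain ⟨g, hg⟩ : ∃ g : V →ₗ[ℚ] ℚ, ∀ i ∈ D, ∀ l ∈ D, l ≠ i → ∃ n : ℤ, n ≠ 0 ∧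
      g (i.toAdd - l.toAdd) = n := by
    obtain ⟨g, hg⟩ := Module.exists_dual_forall_apply_ne_zero (K := ℚ)
      (fun p : {p : D × D // p.1 ≠ p.2} =>
        (p.1.1 : Multiplicative V).toAdd - (p.1.2 : Multiplicative V).toAdd) (by
        rintro ⟨⟨i, l⟩, h⟩ h0
        exact h (Subtype.ext (Multiplicative.toAdd.injective (sub_eq_zero.1 h0))))
    let N : ℕ := ∏ p : D × D,
      (g ((p.1 : Multiplicative V).toAdd - (p.2 : Multiplicative V).toAdd)).den
    have hN : N ≠ 0 :=
      Finset.prod_ne_zero_iff.2 fun p _ => Rat.den_ne_zero _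
    refine ⟨(N : ℚ) • g, fun i hi l hl hne => ?_⟩
    obtain ⟨m, hm⟩ : (g (i.toAdd - l.toAdd)).den ∣ N :=
      Finset.dvd_prod_of_mem (fun p : D × D =>
        (g ((p.1 : Multiplicative V).toAdd - (p.2 : Multiplicative V).toAdd)).den)
        (Finset.mem_univ ((⟨i, hi⟩, ⟨l, hl⟩) : D × D))
    have h0 : g (i.toAdd - l.toAdd) ≠ 0 :=
      hg ⟨(⟨i, hi⟩, ⟨l, hl⟩), by simpa [Subtype.ext_iff] using hne.symm⟩
    refine ⟨m * (g (i.toAdd - l.toAdd)).num, ?_, ?_⟩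
    · refine mul_ne_zero ?_ (by simpa using h0)
      rintro h
      apply hN
      rw [hm]
      simp_all
    · rw [LinearMap.smul_apply, smul_eq_mul, hm]
      push_cast
      rw [mul_right_comm, Rat.den_mul_eq_num]
      ring
  refine ⟨fun v => if v = 1 then 0 else ((|⌊g v.toAdd⌋|.toNat + 1 : ℕ) : Ordinal),
    fun q hq => ?_, fun q => ?_⟩
  · simp only [hq, if_true, if_false]
    exact_mod_cast Nat.succ_pos _
  · obtain ⟨i, hi, hmax⟩ : ∃ i ∈ D, ∀ l ∈ D, (0 ≤ ⌊g q.toAdd⌋ → g l.toAdd ≤ g i.toAdd) ∧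
        (⌊g q.toAdd⌋ < 0 → g i.toAdd ≤ g l.toAdd) := by
      by_cases h0 : 0 ≤ ⌊g q.toAdd⌋
      · obtain ⟨i, hi, h⟩ := D.exists_max_image (fun l => g l.toAdd) hD
        exact ⟨i, hi, fun l hl => ⟨fun _ => h l hl, fun h' => by omega⟩⟩
      · obtain ⟨i, hi, h⟩ := D.exists_min_image (fun l => g l.toAdd) hD
        exact ⟨i, hi, fun l hl => ⟨fun _ => by omega, fun _ => h l hl⟩⟩
    refine ⟨i, hi, fun l hl hne => ?_⟩
    obtain ⟨n, hn0, hn⟩ := hg i hi l hl hne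
    have hfl : ⌊g (l⁻¹ * i * q).toAdd⌋ = n + ⌊g q.toAdd⌋ := by
      have : g (l⁻¹ * i * q).toAdd = n + g q.toAdd := by
        rw [← hn]
        simp
        ring
      rw [this, Int.floor_intCast_add]
    have hne1 : l⁻¹ * i * q ≠ 1 ∨ q ≠ 1 := by
      by_contra! h
      obtain ⟨h1, rfl⟩ := h
      rw [mul_one, inv_mul_eq_one] at h1
      exact hne h1
    rw [map_sub] at hn
    have hlt : |⌊g q.toAdd⌋| < |n + ⌊g q.toAdd⌋| := by
      rcases le_or_gt 0 ⌊g q.toAdd⌋ with h0 | h0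
      · have h2 := (hmax l hl).1 h0
        have h3 : (0 : ℚ) ≤ n := by linarith
        have h4 : 0 ≤ n := by exact_mod_cast h3
        rw [abs_of_nonneg h0, abs_of_nonneg (by omega)]
        omega
      · have h2 := (hmax l hl).2 h0
        have h3 : (n : ℚ) ≤ 0 := by linarith
        have h4 : n ≤ 0 := by exact_mod_cast h3
        rw [abs_of_neg h0, abs_of_neg (by omega)]
        omega
    have hy1 : l⁻¹ * i * q ≠ 1 := by
      intro h
      rw [h] at hfl
      have : n + ⌊g q.toAdd⌋ = 0 := by rw [← hfl]; simp
      rw [this] at hlt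
      simp at hlt
      exact absurd hlt (not_lt.2 (abs_nonneg _))
    simp only [hy1, if_false, hfl]
    split_ifs
    · exact_mod_cast Nat.succ_pos _
    · have := (Int.toNat_lt_toNat (lt_of_le_of_lt (abs_nonneg _) hlt)).2 hlt
      exact_mod_cast Nat.add_lt_add_right this 1

theorem of_subsingleton (Q : Type) [Group Q] [Subsingleton Q] : ExtremallyRanked Q := by
  rintro D ⟨i, hi⟩
  exact ⟨fun _ => 0, fun q hq => absurd (Subsingleton.elim q 1) hq,
    fun q => ⟨i, hi, fun l _ h => absurd (Subsingleton.elim l i) h⟩⟩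

theorem wreath {B : Type} [Group B] (hB : ExtremallyRanked B) :
    ExtremallyRanked ((B → Multiplicative ℚ) ⋊[mulAutArrow] B) := by
  refine of_ker SemidirectProduct.rightHom hB ?_
  let φ : (SemidirectProduct.rightHom : (B → Multiplicative ℚ) ⋊[mulAutArrow] B →* B).ker →*
      Multiplicative (B → ℚ) := MonoidHom.mk' (fun k => .ofAdd fun x => (k.1.left x).toAdd) (by
    rintro ⟨a, ha⟩ ⟨b, hb⟩
    have ha : a.right = 1 := ha
    apply Multiplicative.toAdd.injective
    ext x
    simp [ha])
  refine (of_module (B → ℚ)).of_injective φ fun a b h => ?_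
  apply Subtype.ext
  apply SemidirectProduct.ext
  · ext x
    exact congrFun (congrArg Multiplicative.toAdd h) x
  · exact (show a.1.right = 1 from a.2).trans (show b.1.right = 1 from b.2).symm

end ExtremallyRanked

theorem isSolvable_wreath {B : Type} [Group B] [Group.IsSolvable B] :
    Group.IsSolvable ((B → Multiplicative ℚ) ⋊[mulAutArrow] B) :=
  have : Group.IsSolvable (B → Multiplicative ℚ) := Group.isSolvable_of_comm mul_comm
  Group.isSolvable_of_ker_le_range SemidirectProduct.inl SemidirectProduct.rightHom
    SemidirectProduct.range_inl_eq_ker_rightHom.ge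

/-- The product `g 0 * g 1 * ⋯ * g (n - 1)`. -/
def prefixProd {M : Type*} [Monoid M] (g : ℕ → M) (n : ℕ) : M :=
  ((List.range n).map g).prod

section PrefixProd

variable {M : Type*} [Monoid M]

@[simp] theorem prefixProd_zero (g : ℕ → M) : prefixProd g 0 = 1 := rfl

theorem prefixProd_succ (g : ℕ → M) (n : ℕ) : prefixProd g (n + 1) = prefixProd g n * g n :=
  List.prod_range_succ g n

theorem prefixProd_add (g : ℕ → M) (m n : ℕ) :
    prefixProd g (m + n) = prefixProd g m * prefixProd (fun k => g (m + k)) n := by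
  induction n with
  | zero => simp
  | succ n ih => rw [← add_assoc, prefixProd_succ, ih, prefixProd_succ, mul_assoc]

theorem map_prefixProd {N : Type*} [Monoid N] (φ : M →* N) (g : ℕ → M) (n : ℕ) :
    φ (prefixProd g n) = prefixProd (fun k => φ (g k)) n := by
  simp [prefixProd, map_list_prod, Function.comp_def]

theorem toAdd_prefixProd {A : Type*} [AddCommGroup A] (g : ℕ → Multiplicative A) (n : ℕ) :
    (prefixProd g n).toAdd = ∑ k ∈ Finset.range n, (g k).toAdd := by
  induction n with
  | zero => simp
  | succ n ih => rw [prefixProd_succ, toAdd_mul, ih, Finset.sum_range_succ]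

theorem prefixProd_add_period {g : ℕ → M} {n : ℕ} (hg : Function.Periodic g n) (k : ℕ) :
    prefixProd g (n + k) = prefixProd g n * prefixProd g k := by
  rw [prefixProd_add]
  congr 2
  ext k
  rw [add_comm, hg]

theorem prefixProd_mul_period {g : ℕ → M} {n : ℕ}
    (hg : Function.Periodic g n) (h : prefixProd g n = 1) (m : ℕ) : prefixProd g (n * m) = 1 := by
  induction m with
  | zero => rfl
  | succ m ih => rw [Nat.mul_succ, add_comm, prefixProd_add_period hg, h, ih, one_mul]

theorem prefixProd_eq_one_iff_rotate {G : Type*} [Group G] {g : ℕ → G} {N : ℕ}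
    (hg : Function.Periodic g N) (n : ℕ) :
    prefixProd (fun k => g (n + k)) N = 1 ↔ prefixProd g N = 1 := by
  have h := prefixProd_add g n N
  rw [add_comm, prefixProd_add_period hg] at h
  constructor
  · intro h1
    rwa [h1, mul_one, mul_eq_right] at h
  · intro h1
    rwa [h1, one_mul, left_eq_mul] at h

theorem prefixProd_wreath {A X G : Type*} [Group G] [MulAction G A] [Group X]
    (f : ℕ → A → X) (g : ℕ → G) (n : ℕ) :
    prefixProd (fun k => (⟨f k, g k⟩ : (A → X) ⋊[mulAutArrow] G)) n =
      ⟨fun a => prefixProd (fun k => f k ((prefixProd g k)⁻¹ • a)) n, prefixProd g n⟩ := by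
  induction n with
  | zero => rfl
  | succ n ih =>
    rw [prefixProd_succ, ih]
    ext a
    · rw [SemidirectProduct.mul_left]
      simp only [Pi.mul_apply, prefixProd_succ]
      rfl
    · rw [SemidirectProduct.mul_right]
      simp only [prefixProd_succ]

end PrefixProd

section Separation

variable {S : Type*} {B : Type} [Group B]

/-- The chain on the Cayley graph of `B` consisting of the edges with index in `T` of the lift
at `x` of the word `s`, whose prefixes have images `p` in `B`. Edges are recorded by label and
target. -/
noncomputable def segmentChain (s : ℕ → S) (p : ℕ → B) (T : Finset ℕ) (x : B) : S × B →₀ ℚ :=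
  ∑ k ∈ T, Finsupp.single (s k, (p k)⁻¹ * x) 1

theorem segmentChain_apply_ne_zero {s : ℕ → S} {p : ℕ → B} {T : Finset ℕ} {x : B} {e : S × B} :
    segmentChain s p T x e ≠ 0 ↔ ∃ k ∈ T, (s k, (p k)⁻¹ * x) = e := by
  classical
  rw [segmentChain, Finsupp.finsetSum_apply]
  simp only [Finsupp.single_apply, Finset.sum_boole]
  simp [Finset.filter_eq_empty_iff]

theorem mapDomain_snd_segmentChain_apply_ne_zero {s : ℕ → S} {p : ℕ → B} {T : Finset ℕ} {x y : B} :
    (segmentChain s p T x).mapDomain Prod.snd y ≠ 0 ↔ ∃ k ∈ T, (p k)⁻¹ * x = y := by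
  classical
  rw [segmentChain, Finsupp.mapDomain_finsetSum, Finsupp.finsetSum_apply]
  simp only [Finsupp.mapDomain_single, Finsupp.single_apply, Finset.sum_boole]
  simp [Finset.filter_eq_empty_iff]

theorem eq_smul_segmentChain_of_mem_span (hB : ExtremallyRanked B) {s : ℕ → S} {p : ℕ → B}
    {T U : Finset ℕ} (hTU : T ⊆ U) (hT : T.Nonempty)
    (h : segmentChain s p T 1 ∈ Submodule.span ℚ (Set.range (segmentChain s p U))) :
    ∃ c : ℚ, segmentChain s p T 1 = c • segmentChain s p U 1 := by
  classical
  obtain ⟨c, hc⟩ := Finsupp.mem_span_range_iff_exists_finsupp.1 h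
  have hc0 : c.support.Nonempty := by
    rw [Finsupp.support_nonempty_iff]
    rintro rfl
    obtain ⟨k, hk⟩ := hT
    apply (segmentChain_apply_ne_zero (s := s) (p := p) (x := 1)).2 ⟨k, hk, rfl⟩
    rw [← hc]
    simp
  obtain ⟨ρ, hone, hρ⟩ := hB (U.image fun k => (p k)⁻¹) ((hT.mono hTU).image _)
  obtain ⟨q, hq, hmax⟩ := c.support.exists_max_image ρ hc0
  obtain ⟨i, hi, htop⟩ := hρ q
  have hval : (segmentChain s p T 1).mapDomain Prod.snd (i * q) ≠ 0 := by
    rw [← hc, Finsupp.sum, Finsupp.mapDomain_finsetSum, Finsupp.finsetSum_apply,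
      Finset.sum_eq_single_of_mem q hq]
    · rw [Finsupp.mapDomain_smul, Finsupp.smul_apply, smul_eq_mul]
      obtain ⟨k, hk, rfl⟩ := Finset.mem_image.1 hi
      exact mul_ne_zero (Finsupp.mem_support_iff.1 hq)
        (mapDomain_snd_segmentChain_apply_ne_zero.2 ⟨k, hk, rfl⟩)
    · intro q' hq' hne
      rw [Finsupp.mapDomain_smul, Finsupp.smul_apply, smul_eq_mul]
      refine mul_eq_zero_of_right _ ?_
      by_contra h
      obtain ⟨k, hk, hkq⟩ := mapDomain_snd_segmentChain_apply_ne_zero.1 h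
      have hq'eq : q' = ((p k)⁻¹)⁻¹ * i * q := by rw [mul_assoc, ← hkq, inv_mul_cancel_left]
      by_cases hki : (p k)⁻¹ = i
      · rw [hki] at hkq
        exact hne (mul_left_cancel hkq)
      · exact (htop _ (Finset.mem_image_of_mem _ hk) hki).not_ge (hq'eq ▸ hmax q' hq')
  obtain ⟨k, hk, hkq⟩ := mapDomain_snd_segmentChain_apply_ne_zero.1 hval
  rw [mul_one] at hkq
  have hq1 : q = 1 := by
    by_contra hq1
    have hki : (p k)⁻¹ ≠ i := fun h => hq1 (by simpa [h] using hkq)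
    have := htop _ (Finset.mem_image_of_mem _ (hTU hk)) hki
    rw [mul_assoc, ← hkq, inv_mul_cancel] at this
    exact this.not_gt (hone q hq1)
  subst hq1
  refine ⟨c 1, ?_⟩
  rw [← hc, Finsupp.sum, Finset.sum_eq_single_of_mem 1 hq]
  intro q' hq' hne
  exact absurd (hone q' hne) (hmax q' hq').not_gt

theorem periodic_of_forall_exists_segment {s : ℕ → S} {t : S → B} {n i j : ℕ} (hn : 0 < n)
    (hs : Function.Periodic s n) (hij : i < j)
    (heq : prefixProd (t ∘ s) i = prefixProd (t ∘ s) j)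
    (hinj : Set.InjOn (prefixProd (t ∘ s)) (Set.Ico i j))
    (h : ∀ k, ∃ l ∈ Set.Ico i j, s l = s k ∧ prefixProd (t ∘ s) l = prefixProd (t ∘ s) k) :
    Function.Periodic s (j - i) := by
  have hd : 0 < j - i := by omega
  have hs_of : ∀ k, prefixProd (t ∘ s) (i + k) = prefixProd (t ∘ s) (i + k % (j - i)) →
      s (i + k) = s (i + k % (j - i)) := by
    intro k hk
    obtain ⟨l, hl, hsl, hpl⟩ := h (i + k)
    have hlt := Nat.mod_lt k hd
    rw [← hsl, hinj hl ⟨by omega, by omega⟩ (hpl.trans hk)]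
  have hp : ∀ k, prefixProd (t ∘ s) (i + k) = prefixProd (t ∘ s) (i + k % (j - i)) := by
    intro k
    induction k with
    | zero => simp
    | succ k ih =>
      rw [← add_assoc, prefixProd_succ, Function.comp_apply, hs_of k ih, ih,
        ← Function.comp_apply (f := t), ← prefixProd_succ]
      have hlt := Nat.mod_lt k hd
      rcases Nat.lt_or_ge (k % (j - i) + 1) (j - i) with hlt' | hge
      · rw [Nat.add_mod k 1, Nat.mod_eq_of_lt (a := 1) (by omega), Nat.mod_eq_of_lt hlt',
          add_assoc]
      · have h1 : (k + 1) % (j - i) = 0 := by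
          refine Nat.mod_eq_zero_of_dvd ⟨k / (j - i) + 1, ?_⟩
          have := Nat.div_add_mod k (j - i)
          rw [mul_add]
          omega
        rw [h1, add_zero, heq]
        congr 1
        omega
  have hge : ∀ k, s (i + k + (j - i)) = s (i + k) := by
    intro k
    rw [hs_of k (hp k), add_assoc, hs_of _ (hp (k + (j - i))), Nat.add_mod_right]
  intro k
  have hper : ∀ k, s (k + n * i) = s k := fun k => by
    have := hs.nat_mul i k
    rwa [mul_comm] at this
  obtain ⟨c, hc⟩ : ∃ c, k + n * i = i + c :=
    ⟨k + n * i - i, by have := Nat.le_mul_of_pos_left i hn; omega⟩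
  rw [← hper, ← hper k, hc, ← hge c]
  congr 1
  omega

theorem toAdd_prefixProd_wreath_left (f : (S × B →₀ ℚ) →ₗ[ℚ] ℚ) (s : ℕ → S) (t : S → B) (n : ℕ)
    (x : B) :
    ((prefixProd ((fun a => (⟨fun y => .ofAdd (f (Finsupp.single (a, y) 1)), t a⟩ :
      (B → Multiplicative ℚ) ⋊[mulAutArrow] B)) ∘ s) n).left x).toAdd =
      f (segmentChain s (prefixProd (t ∘ s)) (Finset.range n) x) := by
  refine (congrArg (fun z => (z.left x).toAdd) (prefixProd_wreath
    (fun k (y : B) => Multiplicative.ofAdd (f (Finsupp.single (s k, y) 1))) (t ∘ s) n)).trans ?_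
  rw [toAdd_prefixProd, segmentChain, map_sum]
  rfl

theorem exists_refinement (hB : ExtremallyRanked B) {s : ℕ → S} {n : ℕ}
    (hs : Function.Periodic s n) (hmin : ∀ m, 0 < m → m < n → ¬ Function.Periodic s m)
    {t : S → B} (ht : prefixProd (t ∘ s) n = 1)
    (hbad : ¬ Set.InjOn (prefixProd (t ∘ s)) (Set.Iio n)) :
    ∃ t' : S → (B → Multiplicative ℚ) ⋊[mulAutArrow] B,
      prefixProd (t' ∘ s) n = 1 ∧ (∀ k, (prefixProd (t' ∘ s) k).right = prefixProd (t ∘ s) k) ∧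
      ∃ i < n, ∃ j < n, prefixProd (t ∘ s) i = prefixProd (t ∘ s) j ∧
        prefixProd (t' ∘ s) i ≠ prefixProd (t' ∘ s) j := by
  classical
  have hex : ∃ d, ∃ i, 0 < d ∧ i + d < n ∧
      prefixProd (t ∘ s) i = prefixProd (t ∘ s) (i + d) := by
    simp only [Set.InjOn, Set.mem_Iio] at hbad
    push Not at hbad
    obtain ⟨i, hi, j, hj, h, hne⟩ := hbad
    rcases lt_or_gt_of_ne hne with hlt | hlt
    · exact ⟨j - i, i, by omega, by omega, by rwa [Nat.add_sub_cancel' hlt.le]⟩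
    · exact ⟨i - j, j, by omega, by omega, by rw [Nat.add_sub_cancel' hlt.le, h]⟩
  obtain ⟨i, hd, hdn, heq⟩ := Nat.find_spec hex
  have hshort := fun m (hm : m < Nat.find hex) => Nat.find_min hex hm
  generalize Nat.find hex = d at *
  have hinj : Set.InjOn (prefixProd (t ∘ s)) (Set.Ico i (i + d)) := by
    intro a ha b hb hab
    by_contra hne
    simp only [Set.mem_Ico] at ha hb
    rcases lt_or_gt_of_ne hne with hlt | hlt
    · exact hshort (b - a) (by omega)
        ⟨a, by omega, by omega, by rwa [Nat.add_sub_cancel' hlt.le]⟩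
    · exact hshort (a - b) (by omega)
        ⟨b, by omega, by omega, by rw [Nat.add_sub_cancel' hlt.le, hab]⟩
  let p := prefixProd (t ∘ s)
  have hnot : segmentChain s p (Finset.Ico i (i + d)) 1 ∉
      Submodule.span ℚ (Set.range (segmentChain s p (Finset.range n))) := by
    intro hmem
    obtain ⟨c, hc⟩ := eq_smul_segmentChain_of_mem_span hB
      (fun k hk => Finset.mem_range.2 (by have := Finset.mem_Ico.1 hk; omega))
      (Finset.nonempty_Ico.2 (by omega)) hmem
    have hc0 : c ≠ 0 := by
      rintro rfl
      refine (segmentChain_apply_ne_zero (s := s) (p := p) (x := 1)).2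
        ⟨i, Finset.left_mem_Ico.2 (Nat.lt_add_of_pos_right hd), rfl⟩ ?_
      rw [hc]
      simp
    have hall : ∀ k < n, ∃ l ∈ Set.Ico i (i + d), s l = s k ∧ p l = p k := by
      intro k hk
      have h1 : segmentChain s p (Finset.Ico i (i + d)) 1 (s k, (p k)⁻¹ * 1) ≠ 0 := by
        rw [hc, Finsupp.smul_apply, smul_eq_mul]
        exact mul_ne_zero hc0 (segmentChain_apply_ne_zero.2 ⟨k, Finset.mem_range.2 hk, rfl⟩)
      obtain ⟨l, hl, h⟩ := segmentChain_apply_ne_zero.1 h1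
      simp only [Prod.mk.injEq, mul_one, inv_inj] at h
      exact ⟨l, by simpa using hl, h⟩
    have hpper : Function.Periodic p n := fun k => by
      have hts : Function.Periodic (t ∘ s) n := fun k => congrArg t (hs k)
      simp only [p]
      rw [add_comm, prefixProd_add_period hts, ht, one_mul]
    refine hmin d hd (by omega) ?_
    have := periodic_of_forall_exists_segment (n := n) (i := i) (j := i + d) (t := t) (by omega) hs
      (by omega) heq hinj
      fun k => by
        obtain ⟨l, hl, h1, h2⟩ := hall (k % n) (Nat.mod_lt _ (by omega))
        exact ⟨l, hl, h1.trans (hs.map_mod_nat k), h2.trans (hpper.map_mod_nat k)⟩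
    simpa using this
  obtain ⟨f, hf, hker⟩ := Submodule.exists_le_ker_of_notMem hnot
  have hright : ∀ k, (prefixProd ((fun a => (⟨fun y => .ofAdd (f (Finsupp.single (a, y) 1)), t a⟩ :
      (B → Multiplicative ℚ) ⋊[mulAutArrow] B)) ∘ s) k).right = p k := fun k =>
    map_prefixProd (SemidirectProduct.rightHom) _ k
  refine ⟨fun a => ⟨fun y => .ofAdd (f (Finsupp.single (a, y) 1)), t a⟩, ?_, hright,
    i, by omega, i + d, hdn, heq, ?_⟩
  · apply SemidirectProduct.ext
    · funext x
      apply Multiplicative.toAdd.injective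
      rw [toAdd_prefixProd_wreath_left]
      exact hker (Submodule.subset_span ⟨x, rfl⟩)
    · exact (hright n).trans ht
  · intro h
    have h1 := congrArg (fun z => (z.left 1).toAdd) h
    simp only [toAdd_prefixProd_wreath_left] at h1
    apply hf
    rw [segmentChain, Finset.sum_Ico_eq_sub _ (by omega), map_sub, sub_eq_zero]
    exact h1.symm

theorem exists_separating_hom {s : ℕ → S} {n : ℕ}
    (hs : Function.Periodic s n) (hmin : ∀ m, 0 < m → m < n → ¬ Function.Periodic s m) :
    ∃ (B : Type) (_ : Group B) (t : S → B), Group.IsSolvable B ∧ ExtremallyRanked B ∧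
      prefixProd (t ∘ s) n = 1 ∧ Set.InjOn (prefixProd (t ∘ s)) (Set.Iio n) := by
  suffices H : ∀ (N : ℕ) (B : Type) (_ : Group B) (t : S → B), Group.IsSolvable B →
      ExtremallyRanked B → prefixProd (t ∘ s) n = 1 →
      {x ∈ Set.Iio n ×ˢ Set.Iio n |
        prefixProd (t ∘ s) x.1 = prefixProd (t ∘ s) x.2}.ncard = N →
      ∃ (B : Type) (_ : Group B) (t : S → B), Group.IsSolvable B ∧ ExtremallyRanked B ∧
      prefixProd (t ∘ s) n = 1 ∧ Set.InjOn (prefixProd (t ∘ s)) (Set.Iio n) from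
    H _ Unit inferInstance (fun _ => ()) (Group.isSolvable_of_comm fun _ _ => rfl)
      (ExtremallyRanked.of_subsingleton _) rfl rfl
  intro N
  induction N using Nat.strong_induction_on with
  | _ N ih =>
    rintro B _ t hB hR ht rfl
    by_cases hinj : Set.InjOn (prefixProd (t ∘ s)) (Set.Iio n)
    · exact ⟨B, _, t, hB, hR, ht, hinj⟩
    · obtain ⟨t', ht', hright, i, hi, j, hj, heq, hne⟩ := exists_refinement hR hs hmin ht hinj
      refine ih _ (Set.ncard_lt_ncard ⟨?_, fun hsub => ?_⟩ ?_) _ inferInstance t'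
        isSolvable_wreath hR.wreath ht' rfl
      · exact fun x hx => ⟨hx.1, by rw [← hright, hx.2, hright]⟩
      · exact hne (hsub (show (i, j) ∈ _ from ⟨⟨hi, hj⟩, heq⟩)).2
      · exact ((Set.finite_Iio n).prod (Set.finite_Iio n)).subset fun x hx => hx.1

end Separation

section Freeness

open CategoryTheory ActionCategory

/-- The subgroup `H` is the vertex group of the action groupoid of `G ⧸ H`, and functors from this
groupoid to a group `X` amount to sections `G →* (G ⧸ H → X) ⋊ G`. If these correspond to labellings
of a set of arrows `E`, then `H` is free. -/
theorem isFreeGroup_of_existsUnique_wreath_lift.{u} {G S : Type u} [Group G] (H : Subgroup G)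
    (σ : S → G) (E : Set (S × (G ⧸ H)))
    (h : ∀ (X : Type u) [Group X] (f : S × (G ⧸ H) → X),
      ∃! F : G →* (G ⧸ H → X) ⋊[mulAutArrow] G,
        (∀ g, (F g).right = g) ∧ ∀ e ∈ E, (F (σ e.1)).left e.2 = f e) :
    IsFreeGroup H := by
  classical
  let free : IsFreeGroupoid (ActionCategory G (G ⧸ H)) :=
    { quiverGenerators :=
        ⟨fun a b => {s : S // (s, ActionCategory.back b) ∈ E ∧
          σ s • ActionCategory.back a = ActionCategory.back b}⟩
      of := fun e => ⟨σ e.1, e.2.2⟩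
      unique_lift := by
        intro X _ f
        obtain ⟨F, ⟨hright, hF⟩, huniq⟩ := h X fun e => if he : e ∈ E then
          f (a := (⟨(), (σ e.1)⁻¹ • e.2⟩ : ActionCategory G (G ⧸ H)))
            (b := (⟨(), e.2⟩ : ActionCategory G (G ⧸ H))) ⟨e.1, he, smul_inv_smul _ _⟩ else 1
        refine ⟨uncurry F hright, ?_, ?_⟩
        · rintro ⟨⟨⟩, a⟩ ⟨⟨⟩, b⟩ ⟨s, hs, hab⟩
          obtain rfl := inv_smul_eq_iff.mpr hab.symm
          exact (hF (s, b) hs).trans (dif_pos hs)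
        · intro F' hF'
          have hcurry : curry F' = F := by
            refine huniq _ ⟨fun g => rfl, fun e he => ?_⟩
            rw [dif_pos he]
            exact hF' (⟨(), (σ e.1)⁻¹ • e.2⟩ : ActionCategory G (G ⧸ H))
              (⟨(), e.2⟩ : ActionCategory G (G ⧸ H))
              (show {s : S // (s, e.2) ∈ E ∧ σ s • (σ e.1)⁻¹ • e.2 = e.2} from
                ⟨e.1, he, smul_inv_smul _ _⟩)
          subst hcurry
          refine Functor.hext (fun _ => Unit.ext _ _) ?_
          refine ActionCategory.cases fun t g => ?_
          exact HEq.rfl }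
  have hconn : IsConnected (ActionCategory G (G ⧸ H)) := inferInstance
  have hfree := @IsFreeGroupoid.endIsFreeOfConnectedFree (ActionCategory G (G ⧸ H)) _
    (by with_unfolding_all exact hconn) free (objEquiv G (G ⧸ H) ((1 : G) : G ⧸ H))
  have e := endMulEquivSubgroup H
  with_unfolding_all exact @IsFreeGroup.ofMulEquiv _ _ hfree _ _ e

end Freeness

section Solving

/-- A system of group equations, each of which has a variable occurring in it exactly once and
otherwise only in equations of greater rank, determines the values of these variables. -/
theorem existsUnique_solution {C E X : Type*} [Group X] {N : ℕ} (word : C → ℕ → E) (pos : C → ℕ)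
    (ρ : C → Ordinal.{0}) (hpos : ∀ c, pos c < N)
    (hinj : ∀ c, ∀ k < N, word c k = word c (pos c) → k = pos c)
    (hrank : ∀ c c', c' ≠ c → ∀ k < N, word c k = word c' (pos c') → ρ c' < ρ c) (g : E → X) :
    ∃! f : E → X, (∀ c, prefixProd (fun k => f (word c k)) N = 1) ∧
      ∀ x ∈ (Set.range fun c => word c (pos c))ᶜ, f x = g x := by
  classical
  let e : C → E := fun c => word c (pos c)
  have he : Function.Injective e := by
    intro c c' h
    by_contra hne
    exact (hrank c c' (Ne.symm hne) _ (hpos c) h).asymm (hrank c' c hne _ (hpos c') h.symm)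
  have hsolve : ∀ (f : E → X) (c : C), prefixProd (fun k => f (word c k)) N = 1 ↔
      f (e c) = (prefixProd (fun k => f (word c k)) (pos c))⁻¹ *
        (prefixProd (fun k => f (word c (pos c + (1 + k)))) (N - (pos c + 1)))⁻¹ := by
    intro f c
    obtain ⟨M, hM⟩ := Nat.exists_eq_add_of_lt (hpos c)
    have hsub : N - (pos c + 1) = M := by omega
    rw [hsub, hM, add_assoc, add_comm M 1, prefixProd_add, prefixProd_add, prefixProd_succ,
      prefixProd_zero, one_mul, add_zero, ← mul_assoc, mul_eq_one_iff_eq_inv,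
      ← eq_inv_mul_iff_mul_eq]
  have hcongr : ∀ (f f' : E → X) (c : C),
      (∀ x ∈ (Set.range e)ᶜ, f x = f' x) → (∀ c', ρ c' < ρ c → f (e c') = f' (e c')) →
      (prefixProd (fun k => f (word c k)) (pos c))⁻¹ *
        (prefixProd (fun k => f (word c (pos c + (1 + k)))) (N - (pos c + 1)))⁻¹ =
      (prefixProd (fun k => f' (word c k)) (pos c))⁻¹ *
        (prefixProd (fun k => f' (word c (pos c + (1 + k)))) (N - (pos c + 1)))⁻¹ := by
    intro f f' c h1 h2
    have key : ∀ k < N, k ≠ pos c → f (word c k) = f' (word c k) := by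
      intro k hk hne
      by_cases hx : word c k ∈ Set.range e
      · obtain ⟨c', hc'⟩ := hx
        rw [← hc']
        refine h2 c' (hrank c c' ?_ k hk hc'.symm)
        rintro rfl
        exact hne (hinj _ k hk hc'.symm)
      · exact h1 _ hx
    have := hpos c
    unfold prefixProd
    congr 3
    · exact List.map_congr_left fun k hk => by
        have := List.mem_range.1 hk
        exact key k (by omega) (by omega)
    · exact List.map_congr_left fun k hk => by
        have := List.mem_range.1 hk
        exact key _ (by omega) (by omega)
  let step : (c : C) → ((c' : C) → ρ c' < ρ c → X) → X := fun c h =>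
    let f := Function.extend e (fun c' => if hlt : ρ c' < ρ c then h c' hlt else 1) g
    (prefixProd (fun k => f (word c k)) (pos c))⁻¹ *
      (prefixProd (fun k => f (word c (pos c + (1 + k)))) (N - (pos c + 1)))⁻¹
  have hwf : WellFounded (InvImage (· < ·) ρ) := InvImage.wf ρ Ordinal.lt_wf
  let h : C → X := hwf.fix step
  have hh : ∀ c, h c = step c fun c' _ => h c' := hwf.fix_eq step
  have hout : ∀ (h : C → X), ∀ x ∈ (Set.range e)ᶜ, Function.extend e h g x = g x :=
    fun h x hx => Function.extend_apply' _ _ _ hx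
  refine ⟨Function.extend e h g, ⟨fun c => ?_, hout h⟩, ?_⟩
  · rw [hsolve, he.extend_apply, hh]
    refine hcongr _ _ _ (fun x hx => (hout _ x hx).trans (hout _ x hx).symm) fun c' hlt => ?_
    rw [he.extend_apply, he.extend_apply, dif_pos hlt]
  · rintro f ⟨hf, hfg⟩
    have hfe : ∀ c, f (e c) = h c := by
      intro c
      induction c using hwf.induction with
      | _ c ih =>
        rw [(hsolve f c).1 (hf c), hh]
        refine hcongr _ _ _ (fun x hx => (hfg x hx).trans (hout _ x hx).symm) fun c' hlt => ?_
        rw [he.extend_apply, dif_pos hlt, ih c' hlt]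
    funext x
    by_cases hx : x ∈ Set.range e
    · obtain ⟨c, rfl⟩ := hx
      rw [hfe, he.extend_apply]
    · rw [hout h x hx, hfg x hx]

end Solving

section Lift

variable {S : Type*} {s : ℕ → S} {N : ℕ}

/-- The one-relator group with relator the positive word `s 0 * s 1 * ⋯ * s (N - 1)`. -/
abbrev PositiveOneRelator (s : ℕ → S) (N : ℕ) : Type _ :=
  FreeGroup S ⧸ Subgroup.normalClosure {prefixProd (FreeGroup.of ∘ s) N}

namespace PositiveOneRelator

/-- The image of a generator. -/
def of (s : ℕ → S) (N : ℕ) (x : S) : PositiveOneRelator s N :=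
  QuotientGroup.mk (FreeGroup.of x)

theorem prefixProd_of : prefixProd (of s N ∘ s) N = 1 := by
  refine (map_prefixProd (QuotientGroup.mk' _) (FreeGroup.of ∘ s) N).symm.trans ?_
  exact (QuotientGroup.eq_one_iff _).2 (Subgroup.subset_normalClosure rfl)

/-- The universal property of the one-relator group. -/
def lift {W : Type*} [Group W] (f : S → W) (hf : prefixProd (f ∘ s) N = 1) :
    PositiveOneRelator s N →* W :=
  QuotientGroup.lift _ (FreeGroup.lift f) (by
    refine Subgroup.normalClosure_le_normal (N := (FreeGroup.lift f).ker) ?_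
    rw [Set.singleton_subset_iff, SetLike.mem_coe, MonoidHom.mem_ker, map_prefixProd, ← hf]
    simp [Function.comp_def])

@[simp] theorem lift_of {W : Type*} [Group W] (f : S → W) (hf : prefixProd (f ∘ s) N = 1) (x : S) :
    lift f hf (of s N x) = f x := by
  simp [lift, of]

theorem hom_ext {W : Type*} [Group W] {f g : PositiveOneRelator s N →* W}
    (h : ∀ x, f (of s N x) = g (of s N x)) : f = g :=
  QuotientGroup.monoidHom_ext _ (FreeGroup.ext_hom _ _ h)

theorem existsUnique_wreath_lift {A X : Type*} [MulAction (PositiveOneRelator s N) A] [Group X]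
    (E : Set (S × A)) (g : S × A → X)
    (h : ∃! f : S × A → X,
      (∀ a, prefixProd (fun k => f (s k, (prefixProd (of s N ∘ s) k)⁻¹ • a)) N = 1) ∧
        ∀ e ∈ E, f e = g e) :
    ∃! F : PositiveOneRelator s N →* (A → X) ⋊[mulAutArrow] PositiveOneRelator s N,
      (∀ x, (F x).right = x) ∧ ∀ e ∈ E, (F (of s N e.1)).left e.2 = g e := by
  obtain ⟨f, ⟨hf, hfg⟩, huniq⟩ := h
  have hrel : prefixProd ((fun x => (⟨fun a => f (x, a), of s N x⟩ :
      (A → X) ⋊[mulAutArrow] PositiveOneRelator s N)) ∘ s) N = 1 := by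
    refine (prefixProd_wreath (fun k a => f (s k, a)) (of s N ∘ s) N).trans ?_
    exact SemidirectProduct.ext (funext hf) prefixProd_of
  refine ⟨lift _ hrel, ⟨fun x => ?_, fun e he => ?_⟩, ?_⟩
  · refine DFunLike.congr_fun (f := SemidirectProduct.rightHom.comp (lift _ hrel))
      (g := MonoidHom.id _) (hom_ext fun x => ?_) x
    simp
  · rw [lift_of]
    exact hfg e he
  · rintro F ⟨hright, hleft⟩
    refine hom_ext fun x => ?_
    have hF : ∀ x, F (of s N x) = ⟨(F (of s N x)).left, of s N x⟩ := fun x =>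
      SemidirectProduct.ext rfl (hright _)
    have := huniq (fun e => (F (of s N e.1)).left e.2) ⟨fun a => ?_, hleft⟩
    · rw [lift_of, ← this]
      exact hF x
    · have h1 := map_prefixProd F (of s N ∘ s) N
      rw [prefixProd_of, map_one] at h1
      have h2 := prefixProd_wreath (fun k => (F (of s N (s k))).left) (of s N ∘ s) N
      have h3 := h1.trans ((congrArg (prefixProd · N) (funext fun k => hF (s k))).trans h2)
      exact (congrFun (congrArg SemidirectProduct.left h3) a).symm

end PositiveOneRelator

end Lift

namespace PositiveOneRelator

theorem existsUnique_word_solution.{u} {S : Type u} {s : ℕ → S} {n N : ℕ} [NeZero N] (hn : 0 < n)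
    (hnN : n ∣ N) (hs : Function.Periodic s n) {B : Type} [Group B] (hB : ExtremallyRanked B)
    {t : S → B} (ht : prefixProd (t ∘ s) n = 1)
    (hinj : Set.InjOn (prefixProd (t ∘ s)) (Set.Iio n))
    (π : PositiveOneRelator s N →* B × Multiplicative (ZMod N))
    (hπ : ∀ x, π (of s N x) = (t x, .ofAdd 1)) :
    ∃ E : Set (S × (PositiveOneRelator s N ⧸ π.ker)), ∀ (X : Type u) [Group X]
      (g : S × (PositiveOneRelator s N ⧸ π.ker) → X),
      ∃! f : S × (PositiveOneRelator s N ⧸ π.ker) → X,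
        (∀ a, prefixProd (fun k => f (s k, (prefixProd (of s N ∘ s) k)⁻¹ • a)) N = 1) ∧
          ∀ e ∈ E, f e = g e := by
  classical
  obtain ⟨m, hm⟩ := hnN
  let P := prefixProd (of s N ∘ s)
  let p := prefixProd (t ∘ s)
  let ι := QuotientGroup.kerLift π
  have hι : Function.Injective ι := QuotientGroup.kerLift_injective π
  have hsmul : ∀ x a, ι (x • a) = π x * ι a := by
    intro x a
    induction a using QuotientGroup.induction_on with
    | H y => exact map_mul π x y
  have hP : ∀ k, π (P k) = (p k, .ofAdd (k : ZMod N)) := by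
    intro k
    induction k with
    | zero => simp [P, p]; rfl
    | succ k ih =>
      simp only [P, p, prefixProd_succ, map_mul, Function.comp_apply] at ih ⊢
      rw [ih, hπ, Nat.cast_succ, ofAdd_add]
      rfl
  have hfst : ∀ k a, (ι ((P k)⁻¹ • a)).1 = (p k)⁻¹ * (ι a).1 := fun k a => by
    rw [hsmul, map_inv, hP]
    rfl
  have hsnd : ∀ k a, (ι ((P k)⁻¹ • a)).2.toAdd = (ι a).2.toAdd - k := fun k a => by
    rw [hsmul, map_inv, hP, sub_eq_neg_add]
    rfl
  have htper : Function.Periodic (t ∘ s) n := fun k => congrArg t (hs k)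
  have hp : Function.Periodic p n := fun k => by
    simp only [p]
    rw [add_comm, prefixProd_add_period htper, ht, one_mul]
  have hsN : Function.Periodic s N := by
    rw [hm, mul_comm]
    exact hs.nat_mul m
  have hoper : Function.Periodic (of s N ∘ s) n := fun k => congrArg (of s N) (hs k)
  have hPN : Function.Periodic P N := fun k => by
    have : Function.Periodic (of s N ∘ s) N := fun k => congrArg (of s N) (hsN k)
    simp only [P]
    rw [add_comm, prefixProd_add_period this, prefixProd_of, one_mul]
  obtain ⟨ρ, -, hρ⟩ := hB ((Finset.range n).image fun k => (p k)⁻¹)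
    ((Finset.nonempty_range_iff.2 hn.ne').image _)
  have hpos : ∀ b, ∃ k < n, ∀ l, p l ≠ p k → ρ b < ρ (p l * (p k)⁻¹ * b) := by
    intro b
    obtain ⟨i, hi, h⟩ := hρ b
    obtain ⟨k, hk, rfl⟩ := Finset.mem_image.1 hi
    refine ⟨k, Finset.mem_range.1 hk, fun l hl => ?_⟩
    have := h (p (l % n))⁻¹ (Finset.mem_image_of_mem _ (Finset.mem_range.2 (Nat.mod_lt _ hn)))
    rw [hp.map_mod_nat, inv_inv] at this
    exact this (inv_injective.ne hl)
  choose pos hposlt hpos using hpos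
  have hnleN : n ≤ N := Nat.le_of_dvd (NeZero.pos N) ⟨m, hm⟩
  let C := {a : PositiveOneRelator s N ⧸ π.ker // (ι a).2.toAdd.val < n}
  let word : C → ℕ → S × (PositiveOneRelator s N ⧸ π.ker) := fun c k => (s k, (P k)⁻¹ • c.1)
  let e : C → ℕ := fun c => pos (ι c.1).1
  have hcast : ∀ {k l : ℕ}, k < N → l < N → (k : ZMod N) = l → k = l := by
    intro k l hk hl h
    have := (ZMod.natCast_eq_natCast_iff' _ _ _).1 h
    rwa [Nat.mod_eq_of_lt hk, Nat.mod_eq_of_lt hl] at this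
  refine ⟨(Set.range fun c => word c (e c))ᶜ, fun X _ g => ?_⟩
  have hrot : ∀ (f : S × (PositiveOneRelator s N ⧸ π.ker) → X) a,
      prefixProd (fun k => f (s k, (P k)⁻¹ • (P n)⁻¹ • a)) N = 1 ↔
        prefixProd (fun k => f (s k, (P k)⁻¹ • a)) N = 1 := by
    intro f a
    rw [← prefixProd_eq_one_iff_rotate (g := fun k => f (s k, (P k)⁻¹ • a)) (N := N)
      (fun k => by simp only [hsN k, hPN k]) n]
    have : ∀ k, f (s k, (P k)⁻¹ • (P n)⁻¹ • a) = f (s (n + k), (P (n + k))⁻¹ • a) := by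
      intro k
      simp only [P]
      rw [add_comm n k, hs k, add_comm k n, prefixProd_add_period hoper, mul_inv_rev, mul_smul]
    simp only [this]
  have hall : ∀ f : S × (PositiveOneRelator s N ⧸ π.ker) → X,
      (∀ c, prefixProd (fun k => f (word c k)) N = 1) ↔
        ∀ a, prefixProd (fun k => f (s k, (P k)⁻¹ • a)) N = 1 := by
    refine fun f => ⟨fun h => ?_, fun h c => h c⟩
    have key : ∀ j a, (ι a).2.toAdd.val = j →
        prefixProd (fun k => f (s k, (P k)⁻¹ • a)) N = 1 := by
      intro j
      induction j using Nat.strong_induction_on with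
      | _ j ih =>
        rintro a rfl
        rcases Nat.lt_or_ge (ι a).2.toAdd.val n with hlt | hge
        · exact h ⟨a, hlt⟩
        · rw [← hrot]
          refine ih _ ?_ _ rfl
          have hnval : (n : ZMod N).val = n :=
            ZMod.val_cast_of_lt (hge.trans_lt (ZMod.val_lt _))
          rw [hsnd, ZMod.val_sub (by rwa [hnval]), hnval]
          omega
    exact fun a => key _ a rfl
  have := existsUnique_solution word e (fun c => ρ (ι c.1).1)
    (fun c => (hposlt _).trans_le hnleN) ?_ ?_ g
  · simpa only [hall] using this
  · intro c k hk h
    have h2 := congrArg (fun z => (ι z.2).2.toAdd) h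
    simp only [word, hsnd, sub_right_inj] at h2
    exact hcast hk ((hposlt _).trans_le hnleN) h2
  · intro c c' hne k hk h
    have h1 := congrArg (fun z => (ι z.2).1) h
    have h2 := congrArg (fun z => (ι z.2).2.toAdd) h
    simp only [word, hfst, hsnd] at h1 h2
    have hb : (ι c.1).1 = p k * (p (e c'))⁻¹ * (ι c'.1).1 := by
      rw [mul_assoc, ← h1, mul_inv_cancel_left]
    by_cases hpk : p k = p (e c')
    · exfalso
      apply hne
      have hmod : k % n = e c' := hinj (Nat.mod_lt _ hn) (hposlt _)
        ((hp.map_mod_nat k).trans hpk)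
      have hz : (ι c.1).2.toAdd.val = (ι c'.1).2.toAdd.val := by
        have h3 := congrArg (ZMod.castHom (⟨m, hm⟩ : n ∣ N) (ZMod n)) h2
        rw [map_sub, map_sub, map_natCast, map_natCast, ← hmod, ZMod.natCast_mod,
          sub_left_inj, ← ZMod.natCast_zmod_val (ι c.1).2.toAdd,
          ← ZMod.natCast_zmod_val (ι c'.1).2.toAdd, map_natCast, map_natCast,
          ZMod.natCast_eq_natCast_iff', Nat.mod_eq_of_lt c.2, Nat.mod_eq_of_lt c'.2] at h3
        exact h3
      apply Subtype.ext
      apply hι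
      refine Prod.ext ?_ (Multiplicative.toAdd.injective (ZMod.val_injective N hz.symm))
      rw [hb, hpk, mul_inv_cancel, one_mul]
    · show ρ (ι c'.1).1 < ρ (ι c.1).1
      rw [hb]
      exact hpos _ k hpk

theorem isFreeGroup_ker.{u} {S : Type u} {s : ℕ → S} {n N : ℕ} [NeZero N] (hn : 0 < n)
    (hnN : n ∣ N) (hs : Function.Periodic s n) {B : Type} [Group B] (hB : ExtremallyRanked B)
    {t : S → B} (ht : prefixProd (t ∘ s) n = 1)
    (hinj : Set.InjOn (prefixProd (t ∘ s)) (Set.Iio n))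
    (π : PositiveOneRelator s N →* B × Multiplicative (ZMod N))
    (hπ : ∀ x, π (of s N x) = (t x, .ofAdd 1)) : IsFreeGroup π.ker := by
  obtain ⟨E, hE⟩ := existsUnique_word_solution hn hnN hs hB ht hinj π hπ
  exact isFreeGroup_of_existsUnique_wreath_lift π.ker (of s N) E fun X _ g =>
    existsUnique_wreath_lift E g (hE X g)

end PositiveOneRelator

section DerivedSeries

theorem derivedSeries_add_le_map {G K : Type*} [Group G] [Group K] (f : K →* G) {m : ℕ}
    (h : derivedSeries G m ≤ f.range) (k : ℕ) :
    derivedSeries G (m + k) ≤ (derivedSeries K k).map f := by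
  induction k with
  | zero => rwa [add_zero, derivedSeries_zero, ← MonoidHom.range_eq_map]
  | succ k ih =>
    rw [← add_assoc, derivedSeries_succ, derivedSeries_succ, Subgroup.map_commutator]
    exact Subgroup.commutator_mono ih ih

theorem exists_derivedSeries_le_ker {G Q : Type*} [Group G] [Group Q] (f : G →* Q)
    [Group.IsSolvable Q] : ∃ m, derivedSeries G m ≤ f.ker := by
  obtain ⟨m, hm⟩ := (Group.isSolvable_def Q).1 inferInstance
  refine ⟨m, fun x hx => ?_⟩
  have := map_derivedSeries_le_derivedSeries f m (Subgroup.mem_map_of_mem f hx)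
  rwa [hm, Subgroup.mem_bot] at this

theorem iInf_derivedSeries_eq_bot_of_exact {G K Q : Type*} [Group G] [Group K] [Group Q]
    (i : K →* G) (hi : Function.Injective i) (f : G →* Q) (hif : f.ker ≤ i.range)
    [Group.IsSolvable Q] (hK : ⨅ k, derivedSeries K k = ⊥) : ⨅ k, derivedSeries G k = ⊥ := by
  obtain ⟨m, hm⟩ := exists_derivedSeries_le_ker f
  refine eq_bot_iff.2 fun x hx => ?_
  rw [Subgroup.mem_iInf] at hx
  have hx' := fun k => derivedSeries_add_le_map i (hm.trans hif) k (hx (m + k))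
  obtain ⟨y, -, rfl⟩ := hx' 0
  have hy : y ∈ ⨅ k, derivedSeries K k := Subgroup.mem_iInf.2 fun k => by
    obtain ⟨z, hz, hzy⟩ := hx' k
    rwa [← hi hzy]
  rw [hK, Subgroup.mem_bot] at hy
  rw [hy, map_one]
  exact Subgroup.mem_bot.2 rfl

end DerivedSeries

namespace FreeGroup

variable {S : Type*}

/-- The action of `ℤ` on the free group on `S × ℤ` which translates the second coordinate. -/
def shift (S : Type*) : Multiplicative ℤ →* MulAut (FreeGroup (S × ℤ)) where
  toFun k := freeGroupCongr ((Equiv.refl S).prodCongr (Equiv.addLeft k.toAdd))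
  map_one' := MulEquiv.toMonoidHom_injective (ext_hom _ _ fun x => by simp)
  map_mul' k l := MulEquiv.toMonoidHom_injective
    (ext_hom _ _ fun x => congrArg of (Prod.ext rfl (add_assoc _ _ _)))

theorem shift_of (k : Multiplicative ℤ) (x : S × ℤ) :
    shift S k (of x) = of (x.1, k.toAdd + x.2) := rfl

variable [DecidableEq S]

theorem norm_map_le {T : Type*} [DecidableEq T] (f : S → T) (x : FreeGroup S) :
    norm (map f x) ≤ norm x := by
  rw [← mk_toWord (x := x), map.mk]
  exact norm_mk_le.trans (by simp [norm])

/-- The embedding of a free group in a semidirect product which turns the generator `a` into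
translation. -/
def shiftHom (a : S) : FreeGroup S →* FreeGroup (S × ℤ) ⋊[shift S] Multiplicative ℤ :=
  lift fun b => if b = a then .inr (.ofAdd 1) else .inl (of (b, 0))

theorem shiftHom_injective (a : S) : Function.Injective (shiftHom a) := by
  let unshift : FreeGroup (S × ℤ) ⋊[shift S] Multiplicative ℤ →* FreeGroup S :=
    SemidirectProduct.lift (lift fun x => of a ^ x.2 * of x.1 * (of a ^ x.2)⁻¹)
      (zpowersHom _ (of a)) fun k => ext_hom _ _ fun x => by
        simp [shift_of, zpow_add, mul_assoc, -map_zpow]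
  refine Function.LeftInverse.injective (g := unshift) fun x => ?_
  refine DFunLike.congr_fun (f := unshift.comp (shiftHom a)) (g := MonoidHom.id _)
    (ext_hom _ _ fun b => ?_) x
  by_cases hb : b = a
  · simp [shiftHom, unshift, hb]
  · simp [shiftHom, unshift, hb]

theorem norm_left_shiftHom_le (a : S) (L : List (S × Bool)) :
    norm (shiftHom a (mk L)).left ≤ (L.filter (·.1 ≠ a)).length := by
  induction L with
  | nil => simp [← one_eq_mk]
  | cons x L ih =>
    have hshift : ∀ k, norm (shift S k (shiftHom a (mk L)).left) ≤
        norm (shiftHom a (mk L)).left := fun k => norm_map_le _ _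
    rw [← List.singleton_append, ← mul_mk, _root_.map_mul, SemidirectProduct.mul_left]
    obtain ⟨b, c⟩ := x
    have hmk : mk [(b, c)] = if c then of b else (of b)⁻¹ := by cases c <;> rfl
    refine (norm_mul_le _ _).trans ?_
    have h1 : norm (shiftHom a (mk [(b, c)])).left ≤ if b = a then 0 else 1 := by
      rw [hmk]
      by_cases hb : b = a <;> cases c <;> simp [shiftHom, hb]
    have h2 := (hshift (shiftHom a (mk [(b, c)])).right).trans ih
    by_cases hb : b = a
    · simp only [hb, if_true] at h1 h2 ⊢
      simpa using (Nat.add_le_add h1 h2)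
    · simp only [hb, if_false] at h1 h2 ⊢
      simpa [hb, add_comm] using (Nat.add_le_add h1 h2)

end FreeGroup

theorem FreeGroup.exists_notMem_derivedSeries {S : Type*} [DecidableEq S] (x : FreeGroup S)
    (hx : x ≠ 1) :
    ∃ k, x ∉ derivedSeries (FreeGroup S) k := by
  generalize hn : x.norm = n
  induction n using Nat.strong_induction_on generalizing S with
  | _ n ih =>
    subst hn
    obtain ⟨⟨a, c⟩, L, hL⟩ := List.exists_cons_of_ne_nil (mt toWord_eq_nil_iff.1 hx)
    have hlt : norm (shiftHom a x).left < norm x := by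
      have h := norm_left_shiftHom_le a x.toWord
      rw [mk_toWord, hL, List.filter_cons_of_neg (by simp)] at h
      rw [show norm x = x.toWord.length from rfl, hL, List.length_cons]
      exact Nat.lt_succ_of_le (h.trans (List.length_filter_le _ _))
    have hcomm : Group.IsSolvable (Multiplicative ℤ) := Group.isSolvable_of_comm mul_comm
    by_cases hright : (shiftHom a x).right = 1
    · have hinl : shiftHom a x = .inl (shiftHom a x).left := SemidirectProduct.ext rfl hright
      have hne : (shiftHom a x).left ≠ 1 := fun h => by
        rw [h, _root_.map_one] at hinl
        exact hx (shiftHom_injective a (hinl.trans (_root_.map_one _).symm))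
      obtain ⟨k, hk⟩ := ih _ hlt _ hne rfl
      obtain ⟨m, hm⟩ := exists_derivedSeries_le_ker (SemidirectProduct.rightHom (φ := shift S))
      rw [← SemidirectProduct.range_inl_eq_ker_rightHom] at hm
      refine ⟨m + k, fun hmem => hk ?_⟩
      obtain ⟨y, hy, hyx⟩ := derivedSeries_add_le_map _ hm k
        (map_derivedSeries_le_derivedSeries (shiftHom a) _ (Subgroup.mem_map_of_mem _ hmem))
      rwa [← hyx, SemidirectProduct.left_inl]
    · obtain ⟨m, hm⟩ := exists_derivedSeries_le_ker
        (SemidirectProduct.rightHom.comp (shiftHom a))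
      exact ⟨m, fun hmem => hright (hm hmem)⟩

theorem IsFreeGroup.iInf_derivedSeries_eq_bot (G : Type*) [Group G] [IsFreeGroup G] :
    ⨅ k, derivedSeries G k = ⊥ := by
  classical
  refine eq_bot_iff.2 fun x hx => ?_
  rw [Subgroup.mem_iInf] at hx
  rw [Subgroup.mem_bot]
  by_contra hne
  obtain ⟨k, hk⟩ := FreeGroup.exists_notMem_derivedSeries (IsFreeGroup.toFreeGroup G x)
    (by simpa using hne)
  exact hk (map_derivedSeries_le_derivedSeries (IsFreeGroup.toFreeGroup G).toMonoidHom k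
    (Subgroup.mem_map_of_mem _ (hx k)))

/-- A nontrivial positive word is a power of a word which is not a proper power. -/
theorem exists_periodic_of_mem_closure_range_of {S : Type*} {w : FreeGroup S}
    (hpos : w ∈ Submonoid.closure (Set.range (FreeGroup.of : S → FreeGroup S))) (hw : w ≠ 1) :
    ∃ (s : ℕ → S) (N n : ℕ), N ≠ 0 ∧ 0 < n ∧ n ∣ N ∧ Function.Periodic s n ∧
      (∀ m, 0 < m → m < n → ¬ Function.Periodic s m) ∧
      w = prefixProd (FreeGroup.of ∘ s) N := by
  obtain ⟨L, hL, rfl⟩ : ∃ L : List S, L ≠ [] ∧ (L.map FreeGroup.of).prod = w := by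
    obtain ⟨l, hl, rfl⟩ := Submonoid.exists_list_of_mem_closure hpos
    obtain ⟨L, rfl⟩ : ∃ L : List S, L.map FreeGroup.of = l :=
      (Set.mem_range (f := List.map FreeGroup.of)).1 (by rw [Set.range_list_map]; exact hl)
    exact ⟨L, by rintro rfl; exact hw rfl, rfl⟩
  have hlen := List.length_pos_iff.2 hL
  let s : ℕ → S := fun k => L[k % L.length]'(Nat.mod_lt _ hlen)
  have hsN : Function.Periodic s L.length := fun k => by simp only [s, Nat.add_mod_right]
  let shift : (ℕ → S) → ℕ → S := fun u k => u (k + 1)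
  have hiter : ∀ m u, shift^[m] u = fun k => u (k + m) := by
    intro m
    induction m with
    | zero => exact fun u => rfl
    | succ m ih => exact fun u => (ih _).trans (funext fun k => congrArg u (add_assoc k m 1))
  have hperiod : ∀ m, Function.IsPeriodicPt shift m s ↔ Function.Periodic s m := fun m => by
    rw [Function.IsPeriodicPt, Function.IsFixedPt, hiter, funext_iff]
    rfl
  refine ⟨s, L.length, Function.minimalPeriod shift s, hlen.ne',
    Function.IsPeriodicPt.minimalPeriod_pos hlen ((hperiod _).2 hsN),
    Function.IsPeriodicPt.minimalPeriod_dvd ((hperiod _).2 hsN),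
    (hperiod _).1 (Function.isPeriodicPt_minimalPeriod _ _), fun m h0 hm h =>
      Function.not_isPeriodicPt_of_pos_of_lt_minimalPeriod h0.ne' hm ((hperiod m).2 h), ?_⟩
  unfold prefixProd
  congr 1
  refine List.ext_getElem (by simp) fun k h1 h2 => ?_
  simp only [List.length_map] at h1
  simp [s, Nat.mod_eq_of_lt h1]

/-- A positive one-relator group is free-by-solvable and hence residually
solvable: the intersection of its derived series is trivial. -/
theorem positive_oneRelator_residually_solvable {S : Type*} (w : FreeGroup S)
    (hpos : w ∈ Submonoid.closure (Set.range (FreeGroup.of : S → FreeGroup S)))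
    (hw : w ≠ 1) :
    (∃ (N : Subgroup (FreeGroup S ⧸ Subgroup.normalClosure {w})) (hN : N.Normal),
      IsFreeGroup N ∧
      haveI := hN
      IsSolvable ((FreeGroup S ⧸ Subgroup.normalClosure {w}) ⧸ N)) ∧
    (⨅ i : ℕ, derivedSeries (FreeGroup S ⧸ Subgroup.normalClosure {w}) i) = ⊥ := by
  suffices h : ∃ (Q : Type) (_ : Group Q) (π : FreeGroup S ⧸ Subgroup.normalClosure {w} →* Q),
      Group.IsSolvable Q ∧ IsFreeGroup π.ker by
    obtain ⟨Q, _, π, hQ, hfree⟩ := h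
    refine ⟨⟨π.ker, π.normal_ker, hfree, ?_⟩, ?_⟩
    · exact Group.isSolvable_of_isSolvable_injective (QuotientGroup.kerLift_injective π)
    · exact iInf_derivedSeries_eq_bot_of_exact π.ker.subtype Subtype.val_injective π
        π.ker.range_subtype.ge (IsFreeGroup.iInf_derivedSeries_eq_bot _)
  obtain ⟨s, N, n, hN, hn, hnN, hs, hmin, rfl⟩ := exists_periodic_of_mem_closure_range_of hpos hw
  have : NeZero N := ⟨hN⟩
  obtain ⟨B, _, t, hB, hrank, ht, hinj⟩ := exists_separating_hom hs hmin
  have hrel : prefixProd ((fun x => (t x, Multiplicative.ofAdd (1 : ZMod N))) ∘ s) N = 1 := by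
    obtain ⟨m, rfl⟩ := hnN
    refine Prod.ext ?_ ?_
    · refine (map_prefixProd (MonoidHom.fst B (Multiplicative (ZMod (n * m)))) _ _).trans ?_
      exact prefixProd_mul_period (fun k => congrArg t (hs k)) ht m
    · refine (map_prefixProd (MonoidHom.snd B (Multiplicative (ZMod (n * m)))) _ _).trans ?_
      apply Multiplicative.toAdd.injective
      simp [toAdd_prefixProd]
  refine ⟨B × Multiplicative (ZMod N), inferInstance, PositiveOneRelator.lift _ hrel, ?_,
    PositiveOneRelator.isFreeGroup_ker hn hnN hs hrank ht hinj _ fun x =>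
      PositiveOneRelator.lift_of _ _ x⟩
  have : Group.IsSolvable (Multiplicative (ZMod N)) := Group.isSolvable_of_comm mul_comm
  exact inferInstance
end

section
/- Let A and B be countable groups, let w ∈ A∗B be a cyclically reduced word of syllable length l ≥ 2 that is not a proper power, let n ≥ 1 be an integer, and let G = (A∗B)/⟪wⁿ⟫ be the one-relator product. Suppose φ: G → Q is a group homomorphism to a locally indicable group Q such that φ(u) ≠ 1 for every proper non-empty subword u of w. Then ker(φ) is isomorphic to a free product of a family of groups, each of which is either a free group, or isomorphic to a subgroup of A, or isomorphic to a subgroup of B, or isomorphic to the cyclic group ℤ/nℤ. -/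
/-- A group is locally indicable if every nontrivial finitely generated subgroup surjects
onto `ℤ`. -/
def LocallyIndicable (Q : Type*) [Group Q] : Prop :=
  ∀ H : Subgroup Q, H.FG → H ≠ ⊥ → ∃ f : H →* Multiplicative ℤ, Function.Surjective f

theorem LocallyIndicable.subgroup {Q : Type*} [Group Q] (hQ : LocallyIndicable Q)
    (K : Subgroup Q) : LocallyIndicable K := by
  intro H hH hne
  have e := H.equivMapOfInjective K.subtype K.subtype_injective
  obtain ⟨f, hf⟩ := hQ (H.map K.subtype) (by
      rw [Subgroup.fg_iff_submonoid_fg, Subgroup.map_toSubmonoid]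
      exact ((Subgroup.fg_iff_submonoid_fg H).mp hH).map _)
    (fun h => hne ((Subgroup.map_eq_bot_iff_of_injective H K.subtype_injective).mp h))
  exact ⟨f.comp e.toMonoidHom, hf.comp e.surjective⟩

theorem LocallyIndicable.eq_one_of_pow_eq_one {Q : Type*} [Group Q] (hQ : LocallyIndicable Q)
    {x : Q} {n : ℕ} (hn : n ≠ 0) (hx : x ^ n = 1) : x = 1 := by
  by_contra hne
  obtain ⟨f, hf⟩ := hQ (Subgroup.zpowers x) ⟨{x}, by simp [Subgroup.zpowers_eq_closure]⟩
    (by simpa using hne)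
  obtain ⟨y, hy⟩ := hf (Multiplicative.ofAdd (1 : ℤ))
  have h : y ^ n = 1 := by
    obtain ⟨k, hk⟩ := Subgroup.mem_zpowers_iff.mp y.2
    apply Subtype.ext
    rw [SubgroupClass.coe_pow, OneMemClass.coe_one, ← hk, ← zpow_natCast, ← zpow_mul, mul_comm,
      zpow_mul, zpow_natCast, hx, one_zpow]
  have h' := congrArg f h
  rw [map_pow, hy, map_one f, ← ofAdd_nsmul] at h'
  have : n • (1 : ℤ) = 0 := h'
  simp at this
  exact hn this

/-- A choice of base points `r` in the orbits of the action of `A` on `Q` by left translation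
through `f`, together with elements `s q` of `A` carrying the base points to `q`. -/
structure OrbitSection {A Q : Type*} [Group A] [Group Q] (f : A →* Q) (V : Type*) where
  v : Q → V
  r : V → Q
  s : Q → A
  v_mul : ∀ a q, v (f a * q) = v q
  s_mul_r : ∀ q, f (s q) * r (v q) = q
  v_r : ∀ o, v (r o) = o
  s_r : ∀ o, s (r o) = 1

theorem OrbitSection.exists {A : Type*} {Q : Type u} [Group A] [Group Q] (f : A →* Q) :
    ∃ V : Type u, Nonempty (OrbitSection f V) := by
  have hs : ∀ q : Q, ∃ a : A,
      f a * (Quotient.out (Quotient.mk (QuotientGroup.rightRel f.range) q)) = q := by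
    intro q
    have h := Quotient.mk_out (s := QuotientGroup.rightRel f.range) q
    change QuotientGroup.rightRel f.range _ _ at h
    rw [QuotientGroup.rightRel_apply] at h
    obtain ⟨a, ha⟩ := h
    exact ⟨a, by rw [ha]; group⟩
  choose s hs using hs
  refine ⟨Quotient (QuotientGroup.rightRel f.range), ⟨⟨Quotient.mk _, Quotient.out,
    fun q => s q * (s (Quotient.out (Quotient.mk (QuotientGroup.rightRel f.range) q)))⁻¹,
    ?_, ?_, fun o => Quotient.out_eq o, ?_⟩⟩⟩
  · intro a q
    rw [Quotient.eq, QuotientGroup.rightRel_apply]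
    exact ⟨a⁻¹, by simp⟩
  · intro q
    have h := hs (Quotient.out (Quotient.mk (QuotientGroup.rightRel f.range) q))
    rw [Quotient.out_eq] at h
    have h1 : f (s (Quotient.out (Quotient.mk (QuotientGroup.rightRel f.range) q))) = 1 := by
      simpa using h
    rw [map_mul, map_inv, h1, inv_one, mul_one, hs]
  · intro o
    simp

/-- Left translates of a finite set in a locally indicable group can be eliminated one after
another, each of them having an element which lies in no translate eliminated earlier. -/
theorem LocallyIndicable.exists_wellFounded {Q : Type*} [Group Q] (hQ : LocallyIndicable Q)
    (P : Finset Q) (hP : P.Nonempty) :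
    ∃ p : Q → Q, (∀ q, p q ∈ P) ∧
      WellFounded fun q' q => q' ≠ q ∧ ∃ x ∈ P, p q' * q' = x * q := by
  classical
  induction P using Finset.strongInduction with
  | H P ih =>
  obtain ⟨p₀, hp₀⟩ := hP
  by_cases hsub : ∀ x ∈ P, x = p₀
  · refine ⟨fun _ => p₀, fun _ => hp₀, ⟨fun q => ⟨_, ?_⟩⟩⟩
    rintro q' ⟨hne, x, hx, h⟩
    rw [hsub x hx] at h
    exact absurd (mul_left_cancel h) hne
  push Not at hsub
  obtain ⟨p₁, hp₁, hne⟩ := hsub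
  set H : Subgroup Q := Subgroup.closure ((P.image fun x => x * p₀⁻¹ : Finset Q) : Set Q) with hH
  have hmem : ∀ x ∈ P, x * p₀⁻¹ ∈ H := fun x hx =>
    Subgroup.subset_closure (Finset.mem_coe.mpr (Finset.mem_image_of_mem _ hx))
  obtain ⟨f, hf⟩ := hQ H ⟨_, rfl⟩ (by
    intro h
    have := hmem p₁ hp₁
    rw [h, Subgroup.mem_bot, mul_inv_eq_one] at this
    exact hne this)
  obtain ⟨V, ⟨D⟩⟩ := OrbitSection.exists H.subtype
  have hs : ∀ (h : H) q, D.s (h * q) = h * D.s q := by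
    intro h q
    have h1 := D.s_mul_r (H.subtype h * q)
    rw [D.v_mul] at h1
    have h2 := D.s_mul_r q
    apply Subtype.ext
    have h3 : H.subtype (D.s (H.subtype h * q)) * D.r (D.v q)
        = H.subtype h * H.subtype (D.s q) * D.r (D.v q) := by rw [h1, mul_assoc, h2]
    exact mul_right_cancel h3
  let lev : Q → ℤ := fun q => (f (D.s q)).toAdd
  let g : Q → ℤ := fun x => if hx : x * p₀⁻¹ ∈ H then (f ⟨_, hx⟩).toAdd else 0
  let ℓ : Q → ℤ := fun q => lev (p₀ * q)
  have hlev : ∀ x ∈ P, ∀ q, lev (x * q) = g x + ℓ q := by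
    intro x hx q
    have : x * q = ((⟨_, hmem x hx⟩ : H) : Q) * (p₀ * q) := by simp [mul_assoc]
    simp only [lev, ℓ, g, dif_pos (hmem x hx)]
    rw [this, hs, map_mul, toAdd_mul]
  have hg₀ : g p₀ = 0 := by
    have h := hlev p₀ hp₀ 1
    simp only [ℓ] at h
    omega
  have hg : ∃ x ∈ P, g x ≠ 0 := by
    by_contra! hall
    have hker : H ≤ f.ker.map H.subtype := by
      refine (Subgroup.closure_le _).mpr ?_
      intro y hy
      obtain ⟨x, hx, rfl⟩ := Finset.mem_image.mp (Finset.mem_coe.mp hy)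
      refine ⟨⟨_, hmem x hx⟩, ?_, rfl⟩
      have h := hall x hx
      simp only [g, dif_pos (hmem x hx)] at h
      exact h
    obtain ⟨y, hy⟩ := hf (Multiplicative.ofAdd 1)
    obtain ⟨z, hz, hzy⟩ := hker y.2
    have : z = y := Subtype.ext hzy
    rw [this] at hz
    rw [SetLike.mem_coe, MonoidHom.mem_ker, hy] at hz
    exact absurd (congrArg Multiplicative.toAdd hz) (by simp)
  obtain ⟨x₁, hx₁, hgx₁⟩ := hg
  obtain ⟨xt, hxt, hmax⟩ := P.exists_max_image g ⟨p₀, hp₀⟩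
  obtain ⟨xb, hxb, hmin⟩ := P.exists_min_image g ⟨p₀, hp₀⟩
  have hlt : g xb < g xt := by
    have := hmax x₁ hx₁; have := hmax p₀ hp₀; have := hmin x₁ hx₁; have := hmin p₀ hp₀
    omega
  obtain ⟨pt, hpt, wt⟩ := ih (P.filter fun x => g x = g xt)
    (Finset.filter_ssubset.mpr ⟨xb, hxb, hlt.ne⟩) ⟨xt, by simp [hxt]⟩
  obtain ⟨pb, hpb, wb⟩ := ih (P.filter fun x => g x = g xb)
    (Finset.filter_ssubset.mpr ⟨xt, hxt, hlt.ne'⟩) ⟨xb, by simp [hxb]⟩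
  simp only [Finset.mem_filter] at hpt hpb wt wb
  refine ⟨fun q => if 0 ≤ ℓ q then pt q else pb q, fun q => ?_, ⟨fun q => ?_⟩⟩
  · dsimp only
    split_ifs
    exacts [(hpt q).1, (hpb q).1]
  · obtain ⟨k, hk⟩ : ∃ k, k = (ℓ q).natAbs := ⟨_, rfl⟩
    induction k using Nat.strong_induction_on generalizing q with
    | _ k ihk =>
    by_cases hq : 0 ≤ ℓ q
    · induction q using wt.induction with
      | _ q ihq =>
      refine ⟨_, ?_⟩
      rintro q' ⟨hne, x, hx, h⟩
      dsimp only at h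
      have hh := congrArg lev h
      have := hmax x hx
      have := hmin x hx
      by_cases hq' : 0 ≤ ℓ q'
      · rw [if_pos hq'] at h hh
        rw [hlev _ (hpt q').1, hlev x hx, (hpt q').2] at hh
        by_cases heq : ℓ q' = ℓ q
        · exact ihq q' ⟨hne, x, ⟨hx, by omega⟩, h⟩ (by rw [heq]; exact hk) hq'
        · exact ihk _ (by omega) q' rfl
      · rw [if_neg hq'] at hh
        rw [hlev _ (hpb q').1, hlev x hx, (hpb q').2] at hh
        omega
    · induction q using wb.induction with
      | _ q ihq =>
      refine ⟨_, ?_⟩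
      rintro q' ⟨hne, x, hx, h⟩
      dsimp only at h
      have hh := congrArg lev h
      have := hmax x hx
      have := hmin x hx
      by_cases hq' : 0 ≤ ℓ q'
      · rw [if_pos hq'] at hh
        rw [hlev _ (hpt q').1, hlev x hx, (hpt q').2] at hh
        omega
      · rw [if_neg hq'] at h hh
        rw [hlev _ (hpb q').1, hlev x hx, (hpb q').2] at hh
        by_cases heq : ℓ q' = ℓ q
        · exact ihq q' ⟨hne, x, ⟨hx, by omega⟩, h⟩ (by rw [heq]; exact hk) hq'
        · exact ihk _ (by omega) q' rfl

/-- Triangular systems of equations along a well-founded relation are uniquely solvable. -/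
theorem existsUnique_solution_s7 {I E T : Type*} [DecidableEq E] (e : I → E) (supp : I → Set E)
    (he : ∀ i, e i ∈ supp i) (hwf : WellFounded fun j i => j ≠ i ∧ e j ∈ supp i)
    (F : I → (E → T) → T)
    (hloc : ∀ i t t', (∀ z ∈ supp i, t z = t' z) → F i t = F i t')
    (hbij : ∀ i t x, ∃! y, F i (Function.update t (e i) y) = x) (t₀ : E → T) (x : I → T) :
    ∃! t : E → T, (∀ z, z ∉ Set.range e → t z = t₀ z) ∧ ∀ i, F i t = x i := by
  classical
  have hinj : Function.Injective e := by
    intro i j hij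
    by_contra hne
    exact hwf.asymmetric i j ⟨hne, hij ▸ he j⟩ ⟨Ne.symm hne, hij ▸ he i⟩
  let ext : (I → T) → Set I → E → T := fun y J z =>
    if h : ∃ j, j ∈ J ∧ e j = z then y h.choose else t₀ z
  have hext : ∀ y J j, j ∈ J → ext y J (e j) = y j := by
    intro y J j hj
    have h : ∃ j', j' ∈ J ∧ e j' = e j := ⟨j, hj, rfl⟩
    simp only [ext, dif_pos h]
    rw [hinj h.choose_spec.2]
  have hext' : ∀ y J z, (∀ j ∈ J, e j ≠ z) → ext y J z = t₀ z := by
    intro y J z hz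
    simp only [ext]
    rw [dif_neg]
    rintro ⟨j, hj, h⟩
    exact hz j hj h
  have hy : ∃ y : I → T, ∀ i, F i (Function.update
      (ext y {j | j ≠ i ∧ e j ∈ supp i}) (e i) (y i)) = x i := by
    let y : I → T := hwf.fix fun i rec =>
      (hbij i (fun z => if h : ∃ j, (j ≠ i ∧ e j ∈ supp i) ∧ e j = z then
        rec h.choose h.choose_spec.1 else t₀ z) (x i)).choose
    refine ⟨y, fun i => ?_⟩
    have h : y i = (hbij i (ext y {j | j ≠ i ∧ e j ∈ supp i}) (x i)).choose :=
      hwf.fix_eq _ i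
    rw [h]
    exact (hbij i (ext y {j | j ≠ i ∧ e j ∈ supp i}) (x i)).choose_spec.1
  obtain ⟨y, hy⟩ := hy
  refine ⟨ext y Set.univ, ⟨fun z hz => hext' _ _ _ fun j _ h => hz ⟨j, h⟩, fun i => ?_⟩, ?_⟩
  · rw [← hy i]
    apply hloc
    intro z hz
    by_cases hzi : z = e i
    · subst hzi
      rw [Function.update_self, hext _ _ _ (Set.mem_univ i)]
    · rw [Function.update_of_ne hzi]
      by_cases hzr : ∃ j, e j = z
      · obtain ⟨j, rfl⟩ := hzr
        rw [hext _ _ _ (Set.mem_univ j),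
          hext _ {j | j ≠ i ∧ e j ∈ supp i} _ ⟨fun h => hzi (h ▸ rfl), hz⟩]
      · rw [hext' _ _ _ fun j _ h => hzr ⟨j, h⟩, hext' _ _ _ fun j _ h => hzr ⟨j, h⟩]
  · rintro t ⟨ht₀, ht⟩
    suffices h : ∀ i, t (e i) = ext y Set.univ (e i) by
      funext z
      by_cases hz : ∃ i, e i = z
      · obtain ⟨i, rfl⟩ := hz
        exact h i
      · rw [ht₀ z hz, hext' _ _ _ fun j _ h => hz ⟨j, h⟩]
    intro i
    rw [hext _ _ _ (Set.mem_univ i)]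
    induction i using hwf.induction with
    | _ i ih =>
    refine (hbij i (ext y {j | j ≠ i ∧ e j ∈ supp i}) (x i)).unique ?_ (hy i)
    rw [← ht i]
    apply hloc
    intro z hz
    by_cases hzi : z = e i
    · subst hzi
      rw [Function.update_self]
    · rw [Function.update_of_ne hzi]
      by_cases hzr : ∃ j, e j = z
      · obtain ⟨j, rfl⟩ := hzr
        have hj : j ≠ i := fun h => hzi (h ▸ rfl)
        rw [hext _ {j | j ≠ i ∧ e j ∈ supp i} _ ⟨hj, hz⟩, ih j ⟨hj, hz⟩]
      · rw [ht₀ z hzr, hext' _ _ _ fun j _ h => hzr ⟨j, h⟩]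

/-- Spanning trees of connected graphs, described by what one does with them: transporting
elements of a group along the tree, and propagating equalities. -/
theorem exists_spanningTree {V E : Type*} (a b : E → V) (S : Set E) (v₀ : V)
    (hconn : ∀ X : Set V, v₀ ∈ X → (∀ x ∈ S, a x ∈ X ↔ b x ∈ X) → ∀ v, v ∈ X) :
    ∃ Tr ⊆ S,
      (∀ (G : Type u) [Group G] (γ : E → G) (g₀ : G),
        ∃ σ : V → G, σ v₀ = g₀ ∧ ∀ x ∈ Tr, σ (b x) = γ x * σ (a x)) ∧
      (∀ (T : Type u) (m : V → T), (∀ x ∈ Tr, m (a x) = m (b x)) → ∀ v, m v = m v₀) := by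
  classical
  let X : ℕ → Set V := fun n => Nat.rec (motive := fun _ => Set V) {v₀}
    (fun _ Y => Y ∪ {v | ∃ x ∈ S, (a x = v ∧ b x ∈ Y) ∨ (b x = v ∧ a x ∈ Y)}) n
  have hX : ∀ n v, v ∈ X (n + 1) ↔
      v ∈ X n ∨ ∃ x ∈ S, (a x = v ∧ b x ∈ X n) ∨ (b x = v ∧ a x ∈ X n) := fun _ _ => Iff.rfl
  have hall : ∀ v, ∃ n, v ∈ X n := by
    apply hconn {v | ∃ n, v ∈ X n} ⟨0, rfl⟩
    intro x hx
    constructor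
    · rintro ⟨n, h⟩
      exact ⟨n + 1, (hX n _).mpr (Or.inr ⟨x, hx, Or.inr ⟨rfl, h⟩⟩)⟩
    · rintro ⟨n, h⟩
      exact ⟨n + 1, (hX n _).mpr (Or.inr ⟨x, hx, Or.inl ⟨rfl, h⟩⟩)⟩
  let d : V → ℕ := fun v => Nat.find (hall v)
  have hd_mem : ∀ v, v ∈ X (d v) := fun v => Nat.find_spec (hall v)
  have hd : ∀ v n, v ∈ X n → d v ≤ n := fun v _ h =>
    Nat.find_min' (hall v) h
  have hpar : ∀ v, v ≠ v₀ → ∃ x ∈ S, (a x = v ∧ d (b x) < d v) ∨ (b x = v ∧ d (a x) < d v) := by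
    intro v hv
    have hmem := hd_mem v
    rcases hk : d v with _ | k
    · rw [hk] at hmem
      exact absurd hmem hv
    · rw [hk, hX] at hmem
      rcases hmem with h | ⟨x, hx, ⟨h1, h2⟩ | ⟨h1, h2⟩⟩
      · have := hd v k h
        omega
      · exact ⟨x, hx, Or.inl ⟨h1, Nat.lt_succ_of_le (hd _ _ h2)⟩⟩
      · exact ⟨x, hx, Or.inr ⟨h1, Nat.lt_succ_of_le (hd _ _ h2)⟩⟩
  choose π hπS hπ using hpar
  have hwf : WellFounded fun v v' => d v < d v' := InvImage.wf d Nat.lt_wfRel.wf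
  refine ⟨{x | ∃ v hv, π v hv = x}, ?_, ?_, ?_⟩
  · rintro _ ⟨v, hv, rfl⟩
    exact hπS v hv
  · intro G _ γ g₀
    let σ : V → G := hwf.fix fun v rec =>
      if hv : v = v₀ then g₀
      else if h : a (π v hv) = v ∧ d (b (π v hv)) < d v then
        (γ (π v hv))⁻¹ * rec (b (π v hv)) h.2
      else if h : d (a (π v hv)) < d v then γ (π v hv) * rec (a (π v hv)) h else 1
    have hσ : ∀ v, σ v = if hv : v = v₀ then g₀
      else if a (π v hv) = v ∧ d (b (π v hv)) < d v then (γ (π v hv))⁻¹ * σ (b (π v hv))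
      else if d (a (π v hv)) < d v then γ (π v hv) * σ (a (π v hv)) else 1 :=
      fun v => hwf.fix_eq _ v
    refine ⟨σ, by rw [hσ, dif_pos rfl], ?_⟩
    rintro _ ⟨v, hv, rfl⟩
    have h := hσ v
    rw [dif_neg hv] at h
    by_cases hc : a (π v hv) = v ∧ d (b (π v hv)) < d v
    · rw [if_pos hc] at h
      rw [hc.1, h, mul_inv_cancel_left]
    · have hc' := (hπ v hv).resolve_left hc
      rw [if_neg hc, if_pos hc'.2] at h
      rw [hc'.1, h]
  · intro T m hm v
    induction v using hwf.induction with
    | _ v ih =>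
    by_cases hv : v = v₀
    · rw [hv]
    · have hmv := hm _ ⟨v, hv, rfl⟩
      rcases hπ v hv with ⟨h1, h2⟩ | ⟨h1, h2⟩
      · rw [h1] at hmv
        rw [hmv, ih _ h2]
      · rw [h1] at hmv
        rw [← hmv, ih _ h2]

/-- Cocycles for the action of `G` by left translation through `f` on `Q`. -/
def IsCocycle {G Q T : Type*} [Group G] [Group Q] [Group T] (f : G →* Q) (c : G → Q → T) : Prop :=
  ∀ g h q, c (g * h) q = c g (f h * q) * c h q

namespace IsCocycle

variable {G Q T : Type*} [Group G] [Group Q] [Group T] {f : G →* Q} {c : G → Q → T}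

theorem one (hc : IsCocycle f c) (q : Q) : c 1 q = 1 := by
  have h := hc 1 1 q
  simpa using h

theorem inv (hc : IsCocycle f c) (g : G) (q : Q) : c g⁻¹ (f g * q) = (c g q)⁻¹ := by
  have h := hc g⁻¹ g q
  rw [inv_mul_cancel, hc.one] at h
  exact eq_inv_of_mul_eq_one_left h.symm

theorem pow (hc : IsCocycle f c) {g : G} (hg : f g = 1) (n : ℕ) (q : Q) :
    c (g ^ n) q = c g q ^ n := by
  induction n with
  | zero => simp [hc.one]
  | succ n ih => rw [pow_succ, hc, hg, one_mul, ih, pow_succ]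

theorem conj (hc : IsCocycle f c) (g k : G) (q : Q) (hk : f k * (f g * q) = f g * q) :
    c (g⁻¹ * k * g) q = (c g q)⁻¹ * c k (f g * q) * c g q := by
  rw [hc, hc, hk, hc.inv]

theorem map {T' : Type*} [Group T'] (hc : IsCocycle f c) (θ : T →* T') :
    IsCocycle f fun g q => θ (c g q) := by
  intro g h q
  simp only [hc g h q, map_mul]

theorem comp {G' : Type*} [Group G'] (hc : IsCocycle f c) (i : G' →* G) :
    IsCocycle (f.comp i) fun g q => c (i g) q := by
  intro g h q
  simp only [map_mul, hc (i g) (i h) q, MonoidHom.comp_apply]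

theorem coprod_ext {A B : Type*} [Group A] [Group B] {f : Monoid.Coprod A B →* Q}
    {c c' : Monoid.Coprod A B → Q → T} (hc : IsCocycle f c) (hc' : IsCocycle f c')
    (hA : ∀ a q, c (Monoid.Coprod.inl a) q = c' (Monoid.Coprod.inl a) q)
    (hB : ∀ b q, c (Monoid.Coprod.inr b) q = c' (Monoid.Coprod.inr b) q) (g q) :
    c g q = c' g q := by
  induction g using Monoid.Coprod.induction_on generalizing q with
  | inl a => exact hA a q
  | inr b => exact hB b q
  | mul x y hx hy => rw [hc, hc', hx, hy]

/-- The action on `Q × T` determined by a cocycle. -/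
def toEnd (hc : IsCocycle f c) : G →* Function.End (Q × T) where
  toFun g := fun p => (f g * p.1, c g p.1 * p.2)
  map_one' := by
    funext p
    change _ = p
    simp [hc.one]
  map_mul' g h := by
    funext p
    change _ = (f g * (f h * p.1), c g (f h * p.1) * (c h p.1 * p.2))
    simp [hc g h, mul_assoc]

theorem toEnd_apply (hc : IsCocycle f c) (g : G) (p : Q × T) :
    hc.toEnd g p = (f g * p.1, c g p.1 * p.2) := rfl

theorem exists_coprod {A B : Type*} [Group A] [Group B] {f : Monoid.Coprod A B →* Q}
    {cA : A → Q → T} {cB : B → Q → T}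
    (hA : IsCocycle (f.comp Monoid.Coprod.inl) cA) (hB : IsCocycle (f.comp Monoid.Coprod.inr) cB) :
    ∃ c : Monoid.Coprod A B → Q → T, IsCocycle f c ∧
      (∀ a, c (Monoid.Coprod.inl a) = cA a) ∧ ∀ b, c (Monoid.Coprod.inr b) = cB b := by
  let ρ : Monoid.Coprod A B →* Function.End (Q × T) := Monoid.Coprod.lift hA.toEnd hB.toEnd
  have hρ : ∀ g q x, ρ g (q, x) = (f g * q, (ρ g (q, 1)).2 * x) := by
    intro g
    induction g using Monoid.Coprod.induction_on with
    | inl a => intro q x; simp [ρ, toEnd_apply]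
    | inr b => intro q x; simp [ρ, toEnd_apply]
    | mul g h hg hh =>
      intro q x
      have hmul : ∀ p, ρ (g * h) p = ρ g (ρ h p) := fun p => by rw [map_mul]; rfl
      rw [hmul, hmul, hh q x, hh q 1, hg, hg _ (_ * 1)]
      simp [mul_assoc]
  refine ⟨fun g q => (ρ g (q, 1)).2, ?_, ?_, ?_⟩
  · intro g h q
    have hmul : ρ (g * h) (q, 1) = ρ g (ρ h (q, 1)) := by rw [map_mul]; rfl
    dsimp only
    rw [hmul, hρ h, hρ g]
  · intro a
    funext q
    simp [ρ, toEnd_apply]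
  · intro b
    funext q
    simp [ρ, toEnd_apply]

theorem exists_quotient {R : Set G} {f : G ⧸ Subgroup.normalClosure R →* Q}
    (hc : IsCocycle (f.comp (QuotientGroup.mk' _)) c) (hR : ∀ r ∈ R, ∀ q, c r q = 1) :
    ∃ c' : G ⧸ Subgroup.normalClosure R → Q → T, IsCocycle f c' ∧ ∀ g : G, c' g = c g := by
  have hone : ∀ g ∈ Subgroup.normalClosure R, f (g : G ⧸ Subgroup.normalClosure R) = 1 := by
    intro g hg
    rw [(QuotientGroup.eq_one_iff g).mpr hg, map_one]
  have hN : ∀ g ∈ Subgroup.normalClosure R, ∀ q, c g q = 1 := by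
    intro g hg
    induction hg using Subgroup.closure_induction with
    | mem x hx =>
      obtain ⟨r, hr, hrx⟩ := Group.mem_conjugatesOfSet_iff.mp hx
      obtain ⟨y, rfl⟩ := isConj_iff.mp hrx
      intro q
      have hr1 := hone r (Subgroup.subset_normalClosure hr)
      have h := hc.conj y⁻¹ r q (by simp [hr1])
      rw [inv_inv] at h
      rw [h, hR r hr]
      simp
    | one => exact hc.one
    | mul x y _ _ hx hy => intro q; rw [hc, hx, hy, one_mul]
    | inv x _ hx =>
      intro q
      have h := hc.inv x (f.comp (QuotientGroup.mk' _) x⁻¹ * q)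
      rw [← mul_assoc, ← map_mul, mul_inv_cancel, map_one, one_mul] at h
      rw [h, hx, inv_one]
  refine ⟨fun x => Quotient.liftOn' x c ?_, ?_, fun g => rfl⟩
  · intro g h hgh
    rw [QuotientGroup.leftRel_apply] at hgh
    funext q
    have h1 := hc g (g⁻¹ * h) q
    rw [mul_inv_cancel_left, hN _ hgh, mul_one] at h1
    rw [h1]
    congr 1
    have h2 := hone _ hgh
    rw [MonoidHom.comp_apply, QuotientGroup.mk'_apply, h2, one_mul]
  · intro x y q
    induction x using QuotientGroup.induction_on with
    | H g =>
    induction y using QuotientGroup.induction_on with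
    | H h => exact hc g h q

end IsCocycle

namespace OrbitSection

variable {A Q V T : Type*} [Group A] [Group Q] [Group T] {f : A →* Q}

theorem stab_mem (D : OrbitSection f V) (a : A) (q : Q) :
    (D.s (f a * q))⁻¹ * a * D.s q ∈ f.ker := by
  have h1 := D.s_mul_r (f a * q)
  rw [D.v_mul] at h1
  have h2 := D.s_mul_r q
  rw [MonoidHom.mem_ker, map_mul, map_mul, map_inv, mul_assoc, inv_mul_eq_one]
  apply mul_right_cancel (b := D.r (D.v q))
  rw [h1, mul_assoc, h2]

/-- The element of the stabiliser by which `a` carries `s q` to `s (f a * q)`. -/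
def stab (D : OrbitSection f V) (a : A) (q : Q) : f.ker := ⟨_, D.stab_mem a q⟩

theorem stab_mul (D : OrbitSection f V) (a b : A) (q : Q) :
    D.stab (a * b) q = D.stab a (f b * q) * D.stab b q := by
  apply Subtype.ext
  simp [stab, mul_assoc]

theorem stab_s (D : OrbitSection f V) (q : Q) : D.stab (D.s q) (D.r (D.v q)) = 1 := by
  apply Subtype.ext
  simp [stab, D.s_r, D.s_mul_r]

theorem stab_ker (D : OrbitSection f V) (k : f.ker) (o : V) : D.stab k (D.r o) = k := by
  have hk : f k = 1 := k.2
  apply Subtype.ext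
  simp [stab, D.s_r, hk]

/-- The cocycle with prescribed restrictions `h` to the stabilisers, twisted by `t`. -/
def cocycle (D : OrbitSection f V) (h : V → f.ker →* T) (t : Q → T) (a : A) (q : Q) : T :=
  t (f a * q) * h (D.v q) (D.stab a q) * (t q)⁻¹

theorem isCocycle (D : OrbitSection f V) (h : V → f.ker →* T) (t : Q → T) :
    IsCocycle f (D.cocycle h t) := by
  intro a b q
  simp only [cocycle, stab_mul, map_mul, D.v_mul, mul_assoc, inv_mul_cancel_left]

theorem map_cocycle {T' : Type*} [Group T'] (D : OrbitSection f V) (h : V → f.ker →* T)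
    (t : Q → T) (θ : T →* T') (a : A) (q : Q) :
    θ (D.cocycle h t a q) = D.cocycle (fun v => θ.comp (h v)) (fun q => θ (t q)) a q := by
  simp [cocycle]

theorem cocycle_s (D : OrbitSection f V) (h : V → f.ker →* T) (t : Q → T) (q : Q) :
    D.cocycle h t (D.s q) (D.r (D.v q)) = t q * (t (D.r (D.v q)))⁻¹ := by
  rw [cocycle, stab_s, D.s_mul_r, map_one, mul_one]

theorem cocycle_ker (D : OrbitSection f V) (h : V → f.ker →* T) (t : Q → T) (o : V) (k : f.ker) :
    D.cocycle h t k (D.r o) = t (D.r o) * h o k * (t (D.r o))⁻¹ := by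
  have hk : f k = 1 := k.2
  rw [cocycle, stab_ker, hk, one_mul, D.v_r]

end OrbitSection

section Words

variable {A B G Q T : Type*} [Group A] [Group B] [Group G] [Group Q] [Group T]

/-- The product of a list of syllables. -/
def syllableProd (i : A →* G) (j : B →* G) (L : List (A ⊕ B)) : G :=
  (L.map (Sum.elim i j)).prod

theorem map_syllableProd (f : G →* Q) (i : A →* G) (j : B →* G) (L : List (A ⊕ B)) :
    f (syllableProd i j L) = syllableProd (f.comp i) (f.comp j) L := by
  rw [syllableProd, syllableProd, map_list_prod, List.map_map]
  congr 2
  funext x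
  cases x <;> rfl

variable (fA : A →* Q) (fB : B →* Q)

/-- The value on a word of the cocycle with given values on the syllables. -/
def wordCocycle (cA : A → Q → T) (cB : B → Q → T) : List (A ⊕ B) → Q → T
  | [], _ => 1
  | Sum.inl a :: L, q => cA a (syllableProd fA fB L * q) * wordCocycle cA cB L q
  | Sum.inr b :: L, q => cB b (syllableProd fA fB L * q) * wordCocycle cA cB L q

theorem IsCocycle.syllableProd {f : G →* Q} {c : G → Q → T} (hc : IsCocycle f c)
    (i : A →* G) (j : B →* G) (L : List (A ⊕ B)) (q : Q) :
    c (syllableProd i j L) q = wordCocycle (f.comp i) (f.comp j) (fun a => c (i a))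
      (fun b => c (j b)) L q := by
  induction L with
  | nil => exact hc.one q
  | cons x L ih =>
    have h : _root_.syllableProd i j (x :: L) = Sum.elim i j x * _root_.syllableProd i j L := by
      simp [_root_.syllableProd]
    rw [h, hc, ih, map_syllableProd]
    cases x <;> rfl

/-- The edges crossed by a word, read from `q`. -/
def crossedEdges : List (A ⊕ B) → Q → List Q
  | [], _ => []
  | Sum.inl a :: L, q => fA a * (syllableProd fA fB L * q) :: syllableProd fA fB L * q ::
      crossedEdges L q
  | Sum.inr _ :: L, q => crossedEdges L q

theorem crossedEdges_of_even (k : ℕ) : ∀ (L : List (A ⊕ B)), L.length = 2 * k →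
    L.IsChain (fun x y => x.isLeft ≠ y.isLeft) → ∀ q,
    ((∀ x, L.head? = some x → x.isLeft = true) → crossedEdges fA fB L q =
      (List.range (2 * k)).map fun j => syllableProd fA fB (L.drop j) * q) ∧
    ((∀ x, L.head? = some x → x.isLeft = false) → crossedEdges fA fB L q =
      (List.range (2 * k)).map fun j => syllableProd fA fB (L.drop (j + 1)) * q) := by
  induction k with
  | zero =>
    intro L hL _ q
    obtain rfl : L = [] := by simpa using hL
    simp [crossedEdges]
  | succ k ih =>
    intro L hL hch q
    match L, hL with
    | x :: y :: L, hL =>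
      have hL' : L.length = 2 * k := by simp at hL; omega
      have h1 : x.isLeft ≠ y.isLeft := by
        simpa using (List.isChain_cons_cons.mp hch).1
      have hch' := (List.isChain_cons_cons.mp hch).2
      obtain ⟨ih1, ih2⟩ := ih L hL' (List.IsChain.tail hch') q
      have hy : ∀ z, L.head? = some z → z.isLeft = x.isLeft := by
        intro z hz
        match L, hz with
        | z' :: L, hz =>
          have h2 := (List.isChain_cons_cons.mp hch').1
          have : z' = z := by simpa using hz
          subst this
          revert h1 h2
          cases x.isLeft <;> cases y.isLeft <;> cases z'.isLeft <;> simp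
      have hr : List.range (2 * (k + 1)) = 0 :: 1 :: (List.range (2 * k)).map (· + 2) := by
        rw [show 2 * (k + 1) = 2 * k + 1 + 1 by ring, List.range_succ_eq_map,
          List.range_succ_eq_map]
        simp
      rw [hr]
      match x, y, h1 with
      | Sum.inl a, Sum.inr b, _ =>
        refine ⟨fun _ => ?_, fun h => by simpa using h _ rfl⟩
        rw [crossedEdges, crossedEdges, ih1 hy]
        simp [syllableProd, mul_assoc, Function.comp_def]
      | Sum.inr b, Sum.inl a, _ =>
        refine ⟨fun h => by simpa using h _ rfl, fun _ => ?_⟩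
        rw [crossedEdges, crossedEdges, ih2 hy]
        simp [syllableProd, mul_assoc, Function.comp_def]

theorem even_length_of_isChain {α : Type*} (p : α → Bool) : ∀ (L : List α),
    L.IsChain (fun x y => p x ≠ p y) → ∀ x y, L.head? = some x → L.getLast? = some y →
    (p x ≠ p y ↔ Even L.length)
  | [], _, x, y, hx, _ => by simp at hx
  | [z], _, x, y, hx, hy => by
    simp at hx hy
    simp [← hx, ← hy]
  | z :: z' :: L, hch, x, y, hx, hy => by
    obtain ⟨h1, h2⟩ := List.isChain_cons_cons.mp hch
    have ih := even_length_of_isChain p (z' :: L) h2 z' y rfl (by simpa using hy)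
    have hzx : z = x := by simpa using hx
    subst hzx
    rw [List.length_cons, Nat.even_add_one, ← ih]
    revert h1
    cases p z <;> cases p z' <;> cases p y <;> simp

/-- A cyclically reduced word whose proper subwords are nontrivial in `Q` crosses each edge at
most once. -/
theorem exists_crossedEdges (L : List (A ⊕ B)) (hlen : 2 ≤ L.length)
    (halt : L.IsChain fun x y => x.isLeft ≠ y.isLeft)
    (hcyc : ∀ x y, L.head? = some x → L.getLast? = some y → x.isLeft ≠ y.isLeft)
    (hsub : ∀ i j : ℕ, i ≤ j → j < L.length → ¬(i = 0 ∧ j = L.length - 1) →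
      syllableProd fA fB ((L.drop i).take (j - i + 1)) ≠ 1) :
    ∃ P : Finset Q, P.Nonempty ∧ ∀ q, (crossedEdges fA fB L q).Nodup ∧
      ∀ z, z ∈ crossedEdges fA fB L q ↔ ∃ x ∈ P, z = x * q := by
  classical
  have hne : L ≠ [] := by rintro rfl; simp at hlen
  have heven : Even L.length := (even_length_of_isChain _ L halt _ _ (List.head?_eq_some_head hne)
    (List.getLast?_eq_some_getLast hne)).mp
      (hcyc _ _ (List.head?_eq_some_head hne) (List.getLast?_eq_some_getLast hne))
  obtain ⟨k, hk⟩ := heven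
  rw [← two_mul] at hk
  have key : ∀ i j, i < j → j ≤ L.length → ¬(i = 0 ∧ j = L.length) → ∀ q,
      syllableProd fA fB (L.drop i) * q ≠ syllableProd fA fB (L.drop j) * q := by
    intro i j hij hj hn q h
    refine hsub i (j - 1) (by omega) (by omega) (by omega) ?_
    have h1 := mul_right_cancel h
    have h2 : L.drop i = (L.drop i).take (j - 1 - i + 1) ++ L.drop j := by
      conv_lhs => rw [← List.take_append_drop (j - 1 - i + 1) (L.drop i)]
      rw [List.drop_drop]
      congr 2
      omega
    have h3 : syllableProd fA fB (L.drop i) = syllableProd fA fB ((L.drop i).take (j - 1 - i + 1))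
        * syllableProd fA fB (L.drop j) := by
      conv_lhs => rw [h2]
      simp [syllableProd]
    rw [h1] at h3
    exact (mul_eq_right.mp h3.symm)
  obtain ⟨x, hx⟩ : ∃ x, L.head? = some x := ⟨_, List.head?_eq_some_head hne⟩
  have main : ∃ δ ≤ 1, ∀ q, crossedEdges fA fB L q =
      (List.range (2 * k)).map fun j => syllableProd fA fB (L.drop (j + δ)) * q := by
    by_cases hl : x.isLeft = true
    · exact ⟨0, by omega, fun q => (crossedEdges_of_even fA fB k L hk halt q).1
        fun y hy => by rw [hx] at hy; cases hy; exact hl⟩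
    · exact ⟨1, by omega, fun q => (crossedEdges_of_even fA fB k L hk halt q).2
        fun y hy => by rw [hx] at hy; cases hy; simpa using hl⟩
  obtain ⟨δ, hδ, hL⟩ := main
  refine ⟨(Finset.range (2 * k)).image fun j => syllableProd fA fB (L.drop (j + δ)),
    ⟨_, Finset.mem_image_of_mem _ (Finset.mem_range.mpr (by omega : 0 < 2 * k))⟩, fun q => ⟨?_, ?_⟩⟩
  · rw [hL]
    refine List.Nodup.map_on ?_ List.nodup_range
    intro i hi j hj hij
    rw [List.mem_range] at hi hj
    rcases lt_trichotomy i j with h | h | h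
    · exact absurd hij (key _ _ (by omega) (by omega) (by omega) q)
    · exact h
    · exact absurd hij.symm (key _ _ (by omega) (by omega) (by omega) q)
  · intro z
    rw [hL]
    simp only [List.mem_map, List.mem_range, Finset.mem_image, Finset.mem_range]
    constructor
    · rintro ⟨j, hj, rfl⟩
      exact ⟨_, ⟨j, hj, rfl⟩, rfl⟩
    · rintro ⟨_, ⟨j, hj, rfl⟩, rfl⟩
      exact ⟨j, hj, rfl⟩

variable {fA} {VA : Type*} (D : OrbitSection fA VA) (h : VA → fA.ker →* T) (cB : B → Q → T)

theorem wordCocycle_congr {t t' : Q → T} (L : List (A ⊕ B)) (q : Q)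
    (htt : ∀ z ∈ crossedEdges fA fB L q, t z = t' z) :
    wordCocycle fA fB (D.cocycle h t) cB L q = wordCocycle fA fB (D.cocycle h t') cB L q := by
  induction L with
  | nil => rfl
  | cons x L ih =>
    cases x with
    | inl a =>
      simp only [crossedEdges, List.mem_cons, forall_eq_or_imp] at htt
      simp only [wordCocycle, ih htt.2.2, OrbitSection.cocycle, htt.1, htt.2.1]
    | inr b => simp only [wordCocycle, ih htt]

theorem bijective_wordCocycle_update [DecidableEq Q] (t : Q → T) (L : List (A ⊕ B)) (q : Q)
    (hnd : (crossedEdges fA fB L q).Nodup) (e : Q) (he : e ∈ crossedEdges fA fB L q) :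
    Function.Bijective fun y =>
      wordCocycle fA fB (D.cocycle h (Function.update t e y)) cB L q := by
  induction L with
  | nil => simp [crossedEdges] at he
  | cons x L ih =>
    cases x with
    | inr b => exact (Group.mulLeft_bijective _).comp (ih hnd he)
    | inl a =>
      have hind : e ∉ crossedEdges fA fB L q → ∀ y,
          wordCocycle fA fB (D.cocycle h (Function.update t e y)) cB L q =
          wordCocycle fA fB (D.cocycle h t) cB L q := by
        intro hn y
        apply wordCocycle_congr
        intro z hz
        rw [Function.update_of_ne]
        rintro rfl
        exact hn hz
      simp only [crossedEdges, List.nodup_cons, List.mem_cons, not_or] at hnd he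
      obtain ⟨⟨h1, h2⟩, h3, h4⟩ := hnd
      simp only [wordCocycle, OrbitSection.cocycle]
      rcases he with rfl | rfl | he
      · simp only [hind h2, Function.update_self, Function.update_of_ne (Ne.symm h1), mul_assoc]
        exact Group.mulRight_bijective _
      · simp only [hind h3, Function.update_self, Function.update_of_ne h1]
        exact (Group.mulRight_bijective _).comp
          ((Group.mulLeft_bijective _).comp (Equiv.inv T).bijective)
      · have n1 : fA a * (syllableProd fA fB L * q) ≠ e := by rintro rfl; exact h2 he
        have n2 : syllableProd fA fB L * q ≠ e := by rintro rfl; exact h3 he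
        simp only [Function.update_of_ne n1, Function.update_of_ne n2]
        exact (Group.mulLeft_bijective _).comp (ih h4 he)

end Words

theorem exists_zmod_hom {K : Type*} [Group K] (n : ℕ) (y : K) (hy : y ^ n = 1) :
    ∃ f : Multiplicative (ZMod n) →* K, f (Multiplicative.ofAdd 1) = y := by
  let g : ZMod n →+ Additive K := ZMod.lift n ⟨zmultiplesHom (Additive K) (Additive.ofMul y), by
    simp [← ofMul_pow, hy]⟩
  refine ⟨AddMonoidHom.toMultiplicativeLeft g, ?_⟩
  have h : g ((1 : ℤ) : ZMod n) = Additive.ofMul y := by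
    simp only [g, ZMod.lift_coe]
    simp
  rw [Int.cast_one] at h
  exact h

/-- The family consisting of copies of `X`, `Y` and `Z` and one copy of `W`. -/
def kernelFactor (X Y Z W : Type u) {I J K : Type u} : (I ⊕ J) ⊕ (K ⊕ PUnit.{u + 1}) → Type u
  | Sum.inl (Sum.inl _) => X
  | Sum.inl (Sum.inr _) => Y
  | Sum.inr (Sum.inl _) => Z
  | Sum.inr (Sum.inr _) => W

instance kernelFactor.group (X Y Z W : Type u) [Group X] [Group Y] [Group Z] [Group W]
    {I J K : Type u} : ∀ i : (I ⊕ J) ⊕ (K ⊕ PUnit.{u + 1}), Group (kernelFactor X Y Z W i)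
  | Sum.inl (Sum.inl _) => inferInstanceAs (Group X)
  | Sum.inl (Sum.inr _) => inferInstanceAs (Group Y)
  | Sum.inr (Sum.inl _) => inferInstanceAs (Group Z)
  | Sum.inr (Sum.inr _) => inferInstanceAs (Group W)

/-- The free product of copies of `X`, of copies of `Y`, of copies of `ℤ/nℤ`, and of a free group,
with its universal property and its generators. -/
theorem exists_coprodI (X Y : Type u) [Group X] [Group Y] (n : ℕ) (I J K R : Type u) :
    ∃ (ι : Type u) (H : ι → Type u) (instH : ∀ i, Group (H i)),
      haveI := instH
      (∀ i, IsFreeGroup (H i) ∨ Nonempty (H i ≃* X) ∨ Nonempty (H i ≃* Y) ∨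
        Nonempty (H i ≃* Multiplicative (ZMod n))) ∧
      ∃ (hX : I → X →* Monoid.CoprodI H) (hY : J → Y →* Monoid.CoprodI H)
        (x : K → Monoid.CoprodI H) (y : R → Monoid.CoprodI H),
        (∀ k, x k ^ n = 1) ∧
        (∀ (G : Type u) [Group G] (αX : I → X →* G) (αY : J → Y →* G) (ξ : K → G) (η : R → G),
          (∀ k, ξ k ^ n = 1) → ∃ θ : Monoid.CoprodI H →* G, (∀ i, θ.comp (hX i) = αX i) ∧
            (∀ j, θ.comp (hY j) = αY j) ∧ (∀ k, θ (x k) = ξ k) ∧ ∀ r, θ (y r) = η r) ∧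
        ∀ S : Subgroup (Monoid.CoprodI H), (∀ i a, hX i a ∈ S) → (∀ j a, hY j a ∈ S) →
          (∀ k, x k ∈ S) → (∀ r, y r ∈ S) → ∀ z, z ∈ S := by
  let C := ULift.{u} (Multiplicative (ZMod n))
  let H : (I ⊕ J) ⊕ (K ⊕ PUnit.{u + 1}) → Type u := kernelFactor X Y C (FreeGroup R)
  let oX : I → X →* Monoid.CoprodI H := fun i =>
    Monoid.CoprodI.of (M := H) (i := Sum.inl (Sum.inl i))
  let oY : J → Y →* Monoid.CoprodI H := fun i =>
    Monoid.CoprodI.of (M := H) (i := Sum.inl (Sum.inr i))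
  let oC : K → C →* Monoid.CoprodI H := fun i =>
    Monoid.CoprodI.of (M := H) (i := Sum.inr (Sum.inl i))
  let oF : FreeGroup R →* Monoid.CoprodI H :=
    Monoid.CoprodI.of (M := H) (i := Sum.inr (Sum.inr PUnit.unit))
  refine ⟨_, H, inferInstance, ?_, oX, oY, fun k => oC k ⟨Multiplicative.ofAdd 1⟩,
    fun r => oF (FreeGroup.of r), ?_, ?_, ?_⟩
  · rintro ((i | i) | (i | i))
    · exact Or.inr (Or.inl ⟨MulEquiv.refl X⟩)
    · exact Or.inr (Or.inr (Or.inl ⟨MulEquiv.refl Y⟩))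
    · exact Or.inr (Or.inr (Or.inr ⟨MulEquiv.ulift⟩))
    · exact Or.inl (inferInstanceAs (IsFreeGroup (FreeGroup R)))
  · intro k
    rw [← map_pow]
    convert map_one (oC k)
    apply ULift.ext
    rw [ULift.pow_down, ← ofAdd_nsmul]
    simp
  · intro G _ αX αY ξ η hξ
    choose f hf using fun k => exists_zmod_hom n (ξ k) (hξ k)
    let F : ∀ i, H i →* G := fun i => match i with
      | Sum.inl (Sum.inl i) => αX i
      | Sum.inl (Sum.inr i) => αY i
      | Sum.inr (Sum.inl i) => (f i).comp MulEquiv.ulift.toMonoidHom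
      | Sum.inr (Sum.inr _) => FreeGroup.lift η
    refine ⟨Monoid.CoprodI.lift F, fun i => ?_, fun j => ?_, fun k => ?_, fun r => ?_⟩
    · exact MonoidHom.ext fun a => Monoid.CoprodI.lift_of (i := Sum.inl (Sum.inl i)) F a
    · exact MonoidHom.ext fun a => Monoid.CoprodI.lift_of (i := Sum.inl (Sum.inr j)) F a
    · refine (Monoid.CoprodI.lift_of (i := Sum.inr (Sum.inl k)) F _).trans ?_
      exact hf k
    · refine (Monoid.CoprodI.lift_of (i := Sum.inr (Sum.inr PUnit.unit)) F _).trans ?_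
      exact FreeGroup.lift_apply_of
  · intro S h1 h2 h3 h4 z
    induction z using Monoid.CoprodI.induction_on with
    | one => exact S.one_mem
    | mul a b ha hb => exact S.mul_mem ha hb
    | of i m =>
      match i, m with
      | Sum.inl (Sum.inl i), m => exact h1 i m
      | Sum.inl (Sum.inr i), m => exact h2 i m
      | Sum.inr (Sum.inl i), m =>
        obtain ⟨k, hk⟩ := ZMod.intCast_surjective (Multiplicative.toAdd (ULift.down m))
        have hm : m = (⟨Multiplicative.ofAdd 1⟩ : C) ^ k := by
          apply MulEquiv.ulift.injective
          rw [map_zpow]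
          change Multiplicative.ofAdd (Multiplicative.toAdd (ULift.down m)) =
            Multiplicative.ofAdd (1 : ZMod n) ^ k
          rw [← ofAdd_zsmul, ← hk]
          simp
        have h5 := S.zpow_mem (h3 i) k
        rw [← map_zpow, ← hm] at h5
        exact h5
      | Sum.inr (Sum.inr _), m =>
        change oF m ∈ S
        have h6 : ∀ m : FreeGroup R, oF m ∈ S := by
          intro m
          induction m using FreeGroup.induction_on with
          | C1 => rw [map_one]; exact S.one_mem
          | of r => exact h4 r
          | inv_of r h => rw [map_inv]; exact S.inv_mem h
          | mul a b ha hb => rw [map_mul]; exact S.mul_mem ha hb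
        exact h6 m

section Kernel

variable {A B G Q : Type u} [Group A] [Group B] [Group G] [Group Q]

/-- Cocycles on `G` for the action through `φ` are determined by their restrictions to `A` and `B`,
and compatible cocycles on `A` and `B` extend to `G` as soon as the relation `wⁿ = 1` is respected,
where `w` is the word `L`. -/
structure HasCocycles (φ : G →* Q) (iA : A →* G) (iB : B →* G) (L : List (A ⊕ B)) (n : ℕ) :
    Prop where
  exists_cocycle : ∀ (T : Type u) [Group T] (cA : A → Q → T) (cB : B → Q → T),
    IsCocycle (φ.comp iA) cA → IsCocycle (φ.comp iB) cB →
    (∀ q, wordCocycle (φ.comp iA) (φ.comp iB) cA cB L q ^ n = 1) →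
    ∃ c : G → Q → T, IsCocycle φ c ∧ (∀ a, c (iA a) = cA a) ∧ ∀ b, c (iB b) = cB b
  cocycle_ext : ∀ (T : Type u) [Group T] (c c' : G → Q → T), IsCocycle φ c → IsCocycle φ c' →
    (∀ a q, c (iA a) q = c' (iA a) q) → (∀ b q, c (iB b) q = c' (iB b) q) → ∀ g q, c g q = c' g q
  word_eq_one : φ (syllableProd iA iB L) = 1
  word_pow : syllableProd iA iB L ^ n = 1

theorem hasCocycles_quotient (L : List (A ⊕ B)) (n : ℕ)
    (φ : (Monoid.Coprod A B ⧸ Subgroup.normalClosure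
      {syllableProd (Monoid.Coprod.inl : A →* Monoid.Coprod A B) Monoid.Coprod.inr L ^ n}) →* Q)
    (hφ : φ (syllableProd ((QuotientGroup.mk' _).comp Monoid.Coprod.inl)
      ((QuotientGroup.mk' _).comp Monoid.Coprod.inr) L) = 1) :
    HasCocycles φ ((QuotientGroup.mk' _).comp Monoid.Coprod.inl)
      ((QuotientGroup.mk' _).comp Monoid.Coprod.inr) L n where
  exists_cocycle T _ cA cB hA hB hrel := by
    obtain ⟨c, hc, hcA, hcB⟩ := IsCocycle.exists_coprod (f := φ.comp (QuotientGroup.mk' _)) hA hB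
    obtain ⟨c', hc', hcc⟩ := hc.exists_quotient (by
      intro r hr q
      rw [Set.mem_singleton_iff] at hr
      subst hr
      rw [hc.pow, hc.syllableProd]
      · simp only [hcA, hcB]
        exact hrel q
      · rw [← map_syllableProd] at hφ
        exact hφ)
    exact ⟨c', hc', fun a => (hcc _).trans (hcA a), fun b => (hcc _).trans (hcB b)⟩
  cocycle_ext T _ c c' hc hc' hA hB g q := by
    obtain ⟨g, rfl⟩ := QuotientGroup.mk'_surjective _ g
    exact IsCocycle.coprod_ext (hc.comp (QuotientGroup.mk' _)) (hc'.comp (QuotientGroup.mk' _))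
      hA hB g q
  word_eq_one := hφ
  word_pow := by
    rw [← map_syllableProd, ← map_pow]
    exact (QuotientGroup.eq_one_iff _).mpr (Subgroup.subset_normalClosure rfl)

variable {φ : G →* Q} {iA : A →* G} {iB : B →* G} {L : List (A ⊕ B)} {n : ℕ}

theorem IsCocycle.wordCocycle_eq {T : Type*} [Group T] {c : G → Q → T} (hc : IsCocycle φ c)
    {cA : A → Q → T} {cB : B → Q → T} (hA : ∀ a q, c (iA a) q = cA a q)
    (hB : ∀ b q, c (iB b) q = cB b q) (q : Q) :
    wordCocycle (φ.comp iA) (φ.comp iB) cA cB L q = c (_root_.syllableProd iA iB L) q := by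
  rw [hc.syllableProd]
  congr 1 <;> funext x q
  · exact (hA x q).symm
  · exact (hB x q).symm

/-- The word equations can be solved uniquely for the edge variables in the range of some map. -/
theorem exists_unique_edge_solutions (hQ : LocallyIndicable Q) (fA : A →* Q) (fB : B →* Q)
    {VA : Type u} (DA : OrbitSection fA VA) (hlen : 2 ≤ L.length)
    (halt : L.IsChain fun x y => x.isLeft ≠ y.isLeft)
    (hcyc : ∀ x y, L.head? = some x → L.getLast? = some y → x.isLeft ≠ y.isLeft)
    (hsub : ∀ i j : ℕ, i ≤ j → j < L.length → ¬(i = 0 ∧ j = L.length - 1) →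
      syllableProd fA fB ((L.drop i).take (j - i + 1)) ≠ 1) :
    ∃ E : Set Q, ∀ (T : Type u) [Group T] (h : VA → fA.ker →* T) (cB : B → Q → T) (t₀ x : Q → T),
      ∃! t : Q → T, (∀ z, z ∉ E → t z = t₀ z) ∧
        ∀ q, wordCocycle fA fB (DA.cocycle h t) cB L q = x q := by
  classical
  obtain ⟨P, hP, hcross⟩ := exists_crossedEdges fA fB L hlen halt hcyc hsub
  obtain ⟨p, hp, hwf⟩ := hQ.exists_wellFounded P hP
  have he : ∀ q, p q * q ∈ crossedEdges fA fB L q := fun q =>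
    ((hcross q).2 _).mpr ⟨p q, hp q, rfl⟩
  refine ⟨Set.range fun q => p q * q, fun T _ h cB t₀ x => ?_⟩
  refine existsUnique_solution_s7 (fun q => p q * q) (fun q => {z | z ∈ crossedEdges fA fB L q}) he
    ?_ (fun q t => wordCocycle fA fB (DA.cocycle h t) cB L q) ?_ ?_ t₀ x
  · simpa only [Set.mem_ofPred_eq, (hcross _).2] using hwf
  · exact fun q t t' htt => wordCocycle_congr fB DA h cB L q htt
  · exact fun q t x => (bijective_wordCocycle_update fB DA h cB t L q (hcross q).1 _
      (he q)).existsUnique x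

variable {VA VB : Type u} {DA : OrbitSection (φ.comp iA) VA} {DB : OrbitSection (φ.comp iB) VB}

/-- The graph of orbits, with the eliminated edges removed, is connected. -/
theorem HasCocycles.connected (hG : HasCocycles φ iA iB L n) (hφ : Function.Surjective φ)
    {E : Set Q} (hE : ∀ (T : Type u) [Group T] (h : VA → (φ.comp iA).ker →* T) (cB : B → Q → T)
      (t₀ x : Q → T), ∃! t : Q → T, (∀ z, z ∉ E → t z = t₀ z) ∧
        ∀ q, wordCocycle (φ.comp iA) (φ.comp iB) (DA.cocycle h t) cB L q = x q)
    (X : Set (VA ⊕ VB)) (h₀ : Sum.inr (DB.v 1) ∈ X)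
    (hX : ∀ q ∈ Eᶜ, Sum.inl (DA.v q) ∈ X ↔ Sum.inr (DB.v q) ∈ X) (v : VA ⊕ VB) : v ∈ X := by
  classical
  obtain ⟨T, _, g₀, hg₀⟩ : ∃ (T : Type u) (_ : Group T) (g₀ : T), 1 ≠ g₀ :=
    ⟨ULift.{u} (Multiplicative ℤ), inferInstance, ⟨Multiplicative.ofAdd 1⟩, fun h =>
      zero_ne_one (congrArg (fun x => Multiplicative.toAdd (ULift.down x)) h)⟩
  let m : VA ⊕ VB → T := fun v => if v ∈ X then 1 else g₀
  have hm : ∀ v, m v = 1 → v ∈ X := by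
    intro v hv
    by_contra hn
    simp only [m, if_neg hn] at hv
    exact hg₀ hv.symm
  let t : Q → T := fun q => (m (Sum.inr (DB.v q)))⁻¹ * m (Sum.inl (DA.v q))
  let c : G → Q → T := fun g q => (m (Sum.inr (DB.v (φ g * q))))⁻¹ * m (Sum.inr (DB.v q))
  have hc : IsCocycle φ c := by
    intro g h q
    simp only [c, map_mul, mul_assoc]
    simp
  have hc₁ : IsCocycle φ fun _ _ => (1 : T) := fun _ _ _ => (mul_one _).symm
  have hcA : ∀ a q, c (iA a) q = DA.cocycle (fun _ => 1) t a q := by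
    intro a q
    have h := DA.v_mul a q
    rw [MonoidHom.comp_apply] at h
    simp [c, t, OrbitSection.cocycle, h]
  have hcB : ∀ b q, c (iB b) q = 1 := by
    intro b q
    have h := DB.v_mul b q
    rw [MonoidHom.comp_apply] at h
    simp [c, h]
  have ht : t = fun _ => 1 := by
    refine (hE T (fun _ => 1) (fun _ _ => 1) (fun _ => 1) (fun _ => 1)).unique
      ⟨fun z hz => ?_, fun q => ?_⟩ ⟨fun _ _ => rfl, fun q => ?_⟩
    · simp only [t, m, hX z hz, inv_mul_cancel]
    · rw [hc.wordCocycle_eq hcA hcB]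
      simp [c, hG.word_eq_one]
    · exact hc₁.wordCocycle_eq (by simp [OrbitSection.cocycle]) (fun _ _ => rfl) q
  have hc1 : ∀ g q, c g q = 1 := by
    refine hG.cocycle_ext T c (fun _ _ => 1) hc hc₁ (fun a q => ?_) hcB
    rw [hcA, ht]
    simp [OrbitSection.cocycle]
  have hmB : ∀ q, m (Sum.inr (DB.v q)) = 1 := by
    intro q
    obtain ⟨g, rfl⟩ := hφ q
    have h := hc1 g 1
    simp only [c, mul_one, inv_mul_eq_one] at h
    rw [h]
    exact if_pos h₀
  have hmA : ∀ q, m (Sum.inl (DA.v q)) = 1 := by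
    intro q
    have h := congrFun ht q
    simp only [t, inv_mul_eq_one] at h
    rw [← h, hmB]
  rcases v with o | o
  · exact hm _ (by rw [← DA.v_r o]; exact hmA _)
  · exact hm _ (by rw [← DB.v_r o]; exact hmB _)

/-- Conjugation by `s` from the kernel of `φ.comp i` to the kernel of `φ`. -/
def conjKer (φ : G →* Q) (i : A →* G) (s : G) : (φ.comp i).ker →* φ.ker where
  toFun k := ⟨s⁻¹ * i k * s, by
    have hk : φ (i k) = 1 := k.2
    simp [MonoidHom.mem_ker, hk]⟩
  map_one' := by ext; simp
  map_mul' k k' := by ext; simp [mul_assoc]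

/-- The cocycle with values in the kernel obtained from a section of `φ`. -/
def kerCocycle (φ : G →* Q) (τ : Q → G) (hτ : ∀ q, φ (τ q) = q) (g : G) (q : Q) : φ.ker :=
  ⟨(τ (φ g * q))⁻¹ * g * τ q, by simp [MonoidHom.mem_ker, hτ, mul_assoc]⟩

theorem isCocycle_kerCocycle (τ : Q → G) (hτ : ∀ q, φ (τ q) = q) :
    IsCocycle φ (kerCocycle φ τ hτ) := by
  intro g h q
  ext
  simp [kerCocycle, mul_assoc]

theorem HasCocycles.exists_mulEquiv_ker (hG : HasCocycles φ iA iB L n)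
    (hφ : Function.Surjective φ) (DA : OrbitSection (φ.comp iA) VA)
    (DB : OrbitSection (φ.comp iB) VB)
    {E : Set Q} (hE : ∀ (T : Type u) [Group T] (h : VA → (φ.comp iA).ker →* T) (cB : B → Q → T)
      (t₀ x : Q → T), ∃! t : Q → T, (∀ z, z ∉ E → t z = t₀ z) ∧
        ∀ q, wordCocycle (φ.comp iA) (φ.comp iB) (DA.cocycle h t) cB L q = x q) :
    ∃ (ι : Type u) (H : ι → Type u) (instH : ∀ i, Group (H i)),
      haveI := instH
      (∀ i, IsFreeGroup (H i) ∨ Nonempty (H i ≃* (φ.comp iA).ker) ∨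
        Nonempty (H i ≃* (φ.comp iB).ker) ∨ Nonempty (H i ≃* Multiplicative (ZMod n))) ∧
      Nonempty (φ.ker ≃* Monoid.CoprodI H) := by
  classical
  obtain ⟨Tr, hTr, htree, hconst⟩ := exists_spanningTree.{u} (fun q => Sum.inl (DA.v q))
    (fun q => Sum.inr (DB.v q)) Eᶜ (Sum.inr (DB.v 1) : VA ⊕ VB) (hG.connected hφ hE)
  obtain ⟨g₀, hg₀⟩ := hφ (DB.r (DB.v 1))
  obtain ⟨σ, hσ₀, hσ⟩ := htree G (fun q => (iB (DB.s q))⁻¹ * iA (DA.s q)) g₀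
  have hsA : ∀ q, φ (iA (DA.s q)) * DA.r (DA.v q) = q := DA.s_mul_r
  have hsB : ∀ q, φ (iB (DB.s q)) * DB.r (DB.v q) = q := DB.s_mul_r
  have hφσ : ∀ v, φ (σ v) = Sum.elim DA.r DB.r v := by
    have h := hconst Q (fun v => (Sum.elim DA.r DB.r v)⁻¹ * φ (σ v)) (by
      intro q hq
      have h1 := eq_mul_inv_of_mul_eq (hsA q)
      have h2 := eq_mul_inv_of_mul_eq (hsB q)
      rw [hσ q hq]
      simp only [Sum.elim_inl, Sum.elim_inr, map_mul, map_inv, h1, h2]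
      group)
    intro v
    have h1 := h v
    rw [hσ₀, hg₀] at h1
    simp only [Sum.elim_inr, inv_mul_cancel, inv_mul_eq_one] at h1
    exact h1.symm
  have hφA : ∀ o, φ (σ (Sum.inl o)) = DA.r o := fun o => hφσ _
  have hφB : ∀ o, φ (σ (Sum.inr o)) = DB.r o := fun o => hφσ _
  let τ : Q → G := fun q => iB (DB.s q) * σ (Sum.inr (DB.v q))
  let τ' : Q → G := fun q => iA (DA.s q) * σ (Sum.inl (DA.v q))
  have hτ : ∀ q, φ (τ q) = q := fun q => by simp only [τ, map_mul, hφB, hsB]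
  have hτ' : ∀ q, φ (τ' q) = q := fun q => by simp only [τ', map_mul, hφA, hsA]
  have hττ' : ∀ q ∈ Tr, τ q = τ' q := by
    intro q hq
    simp only [τ, τ', hσ q hq]
    group
  let t' : Q → φ.ker := fun q => ⟨(τ q)⁻¹ * τ' q, by simp [MonoidHom.mem_ker, hτ, hτ']⟩
  have ht'Tr : ∀ q ∈ Tr, t' q = 1 := by
    intro q hq
    ext
    simp [t', hττ' q hq]
  let d := kerCocycle φ τ hτ
  have hd : IsCocycle φ d := isCocycle_kerCocycle τ hτ
  let αA : VA → (φ.comp iA).ker →* φ.ker := fun o => conjKer φ iA (σ (Sum.inl o))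
  let αB : VB → (φ.comp iB).ker →* φ.ker := fun o => conjKer φ iB (σ (Sum.inr o))
  have hdA : ∀ a q, d (iA a) q = DA.cocycle αA t' a q := by
    intro a q
    have h := DA.v_mul a q
    ext
    simp only [MonoidHom.comp_apply] at h
    simp [d, kerCocycle, OrbitSection.cocycle, t', αA, conjKer, OrbitSection.stab, τ', h, mul_assoc]
  have hdB : ∀ b q, d (iB b) q = DB.cocycle αB (fun _ => 1) b q := by
    intro b q
    have h := DB.v_mul b q
    ext
    simp only [MonoidHom.comp_apply] at h
    simp [d, kerCocycle, OrbitSection.cocycle, αB, conjKer, OrbitSection.stab, τ, h, mul_assoc]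
  obtain ⟨ι, H, instH, hH, oX, oY, x, y, hx, huniv, hgen⟩ := exists_coprodI
    (φ.comp iA).ker (φ.comp iB).ker n VA VB Q {q // q ∉ E ∧ q ∉ Tr}
  refine ⟨ι, H, instH, hH, ?_⟩
  obtain ⟨t, ⟨ht₀, htx⟩, -⟩ := hE (Monoid.CoprodI H) oX (DB.cocycle oY fun _ => 1)
    (fun q => if h : q ∉ E ∧ q ∉ Tr then y ⟨q, h⟩ else 1) x
  have htR : ∀ r, t r.1 = y r := fun r => by rw [ht₀ _ r.2.1, dif_pos r.2]
  have htTr : ∀ q ∈ Tr, t q = 1 := fun q hq => by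
    rw [ht₀ _ (hTr hq), dif_neg (fun h => h.2 hq)]
  obtain ⟨c, hc, hcA, hcB⟩ := hG.exists_cocycle (Monoid.CoprodI H) (DA.cocycle oX t)
    (DB.cocycle oY fun _ => 1) (DA.isCocycle _ _) (DB.isCocycle _ _)
    (fun q => by rw [htx, hx])
  have hcw : ∀ q, c (syllableProd iA iB L) q = x q := fun q => by
    rw [← htx, hc.wordCocycle_eq (fun a q => by rw [hcA]) (fun b q => by rw [hcB])]
  let ψ : φ.ker →* Monoid.CoprodI H :=
    { toFun := fun k => c k 1
      map_one' := hc.one 1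
      map_mul' := fun k k' => by
        have hk : φ k' = 1 := k'.2
        rw [Subgroup.coe_mul, hc, hk, one_mul] }
  have hψ : ∀ k, ψ k = c k 1 := fun _ => rfl
  have hinj : Function.Injective ψ := by
    obtain ⟨θ, hθA, hθB, hθx, hθy⟩ := huniv φ.ker αA αB (fun q => d (syllableProd iA iB L) q)
      (fun r => t' r.1) (fun q => by
        rw [← hd.pow hG.word_eq_one, hG.word_pow, hd.one])
    have hcθ := hc.map θ
    have hcθA : ∀ a q, θ (c (iA a) q) = DA.cocycle αA (fun q => θ (t q)) a q := by
      intro a q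
      rw [hcA, DA.map_cocycle]
      simp only [hθA]
    have hcθB : ∀ b q, θ (c (iB b) q) = DB.cocycle αB (fun _ => 1) b q := by
      intro b q
      rw [hcB, DB.map_cocycle]
      simp only [hθB, map_one]
    have htt' : (fun q => θ (t q)) = t' := by
      refine (hE φ.ker αA (DB.cocycle αB fun _ => 1) t' fun q => d (syllableProd iA iB L) q).unique
        ⟨fun z hz => ?_, fun q => ?_⟩ ⟨fun _ _ => rfl, fun q => ?_⟩
      · by_cases hzT : z ∈ Tr
        · rw [htTr z hzT, ht'Tr z hzT, map_one]
        · rw [← hθy ⟨z, hz, hzT⟩, ← htR]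
      · rw [hcθ.wordCocycle_eq hcθA hcθB, hcw, hθx]
      · exact hd.wordCocycle_eq hdA hdB q
    have hcd : ∀ g q, θ (c g q) = d g q := by
      refine hG.cocycle_ext _ _ _ hcθ hd (fun a q => ?_) (fun b q => ?_)
      · rw [hcθA, hdA, htt']
      · rw [hcθB, hdB]
    rw [injective_iff_map_eq_one]
    intro k hk
    have h := hcd k 1
    rw [← hψ, hk, map_one] at h
    have hk1 : φ k = 1 := k.2
    have h1 := congrArg Subtype.val h
    simp only [d, kerCocycle, hk1, mul_one, OneMemClass.coe_one] at h1
    ext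
    rw [OneMemClass.coe_one]
    rw [mul_assoc, eq_inv_mul_iff_mul_eq, mul_one] at h1
    exact mul_eq_right.mp h1.symm
  have hsurj : Function.Surjective ψ := by
    have hτm : ∀ q, c (τ q) 1 = c (σ (Sum.inr (DB.v q))) 1 := by
      intro q
      have h := DB.cocycle_s oY (fun _ => 1) q
      rw [← hcB, inv_one, mul_one] at h
      simp only [τ]
      rw [hc, hφB, mul_one, h, one_mul]
    have hτ'm : ∀ q, c (τ' q) 1 =
        t q * ((t (DA.r (DA.v q)))⁻¹ * c (σ (Sum.inl (DA.v q))) 1) := by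
      intro q
      have h := DA.cocycle_s oX t q
      rw [← hcA] at h
      simp only [τ']
      rw [hc, hφA, mul_one, h, mul_assoc]
    obtain ⟨M, hM⟩ : ∃ M, ∀ v, Sum.elim (fun o => (t (DA.r o))⁻¹ * c (σ (Sum.inl o)) 1)
        (fun o => c (σ (Sum.inr o)) 1) v = M := by
      refine ⟨_, hconst (Monoid.CoprodI H) _ fun q hq => ?_⟩
      rw [Sum.elim_inl, Sum.elim_inr, ← hτm, hττ' q hq, hτ'm, htTr q hq, one_mul]
    have hMA : ∀ o, (t (DA.r o))⁻¹ * c (σ (Sum.inl o)) 1 = M := fun o => hM (Sum.inl o)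
    have hMB : ∀ o, c (σ (Sum.inr o)) 1 = M := fun o => hM (Sum.inr o)
    have hτM : ∀ q, c (τ q) 1 = M := fun q => by rw [hτm, hMB]
    have hτ'M : ∀ q, c (τ' q) 1 = t q * M := fun q => by rw [hτ'm, hMA]
    have hall := hgen (ψ.range.comap (MulAut.conj M⁻¹).toMonoidHom)
    have hmem : ∀ z, M⁻¹ * z * M ∈ ψ.range := by
      intro z
      have h := hall ?_ ?_ ?_ ?_ z
      · simpa using h
      · intro o k
        have hk : φ (iA k) = 1 := k.2
        refine ⟨αA o k, ?_⟩
        have h1 := DA.cocycle_ker oX t o k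
        rw [← hcA] at h1
        have h2 := hc.conj (σ (Sum.inl o)) (iA k) 1 (by rw [hk, one_mul])
        rw [hφA, mul_one, h1] at h2
        rw [hψ]
        refine h2.trans ?_
        simp [← hMA o, mul_assoc]
      · intro o k
        have hk : φ (iB k) = 1 := k.2
        refine ⟨αB o k, ?_⟩
        have h1 := DB.cocycle_ker oY (fun _ => 1) o k
        rw [← hcB] at h1
        have h2 := hc.conj (σ (Sum.inr o)) (iB k) 1 (by rw [hk, one_mul])
        rw [hφB, mul_one, h1, hMB] at h2
        rw [hψ]
        refine h2.trans ?_
        simp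
      · intro q
        refine ⟨d (syllableProd iA iB L) q, ?_⟩
        have h2 := hc.conj (τ q) (syllableProd iA iB L) 1 (by rw [hG.word_eq_one, one_mul])
        rw [hτ, mul_one, hcw, hτM] at h2
        simp only [hψ, d, kerCocycle, hG.word_eq_one, one_mul]
        rw [h2]
        simp
      · intro r
        refine ⟨t' r.1, ?_⟩
        have h1 := hc.inv (τ r.1) 1
        rw [hτ, hτM] at h1
        simp only [hψ, t']
        rw [hc, hτ', h1, hτ'M, htR]
        simp [mul_assoc]
    intro z
    obtain ⟨k, hk⟩ := hmem (M * z * M⁻¹)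
    exact ⟨k, by rw [hk]; group⟩
  exact ⟨MulEquiv.ofBijective ψ ⟨hinj, hsurj⟩⟩

end Kernel

/-- Let `w ∈ A ∗ B` be a cyclically reduced word of syllable length at
least two (recorded by its list `L` of syllables) which is not a proper power, let `n ≥ 1`
and let `G = (A ∗ B)/⟪wⁿ⟫`. If `φ : G → Q` is a homomorphism to a locally indicable group
which is nontrivial on every proper non-empty subword of `w`, then `ker φ` is a free product
of groups, each of which is free, a subgroup of `A`, a subgroup of `B`, or a copy of
`ℤ/nℤ`. -/
theorem kernel_free_product_oneRelatorProduct {A B : Type u} [Group A] [Group B]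
    [Countable A] [Countable B]
    (w : Monoid.Coprod A B) (L : List (A ⊕ B)) (n : ℕ) (hn : 1 ≤ n)
    (hlen : 2 ≤ L.length)
    (hsyl : ∀ x ∈ L, x ≠ Sum.inl 1 ∧ x ≠ Sum.inr 1)
    (halt : L.Chain' fun x y => x.isLeft ≠ y.isLeft)
    (hcyc : ∀ x y, L.head? = some x → L.getLast? = some y → x.isLeft ≠ y.isLeft)
    (hw : w = (L.map (Sum.elim (Monoid.Coprod.inl : A →* Monoid.Coprod A B)
      (Monoid.Coprod.inr : B →* Monoid.Coprod A B))).prod)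
    (hnp : ¬ ∃ (v : Monoid.Coprod A B) (m : ℕ), 2 ≤ m ∧ w = v ^ m)
    {Q : Type u} [Group Q] (hQ : LocallyIndicable Q)
    (φ : (Monoid.Coprod A B ⧸ Subgroup.normalClosure {w ^ n}) →* Q)
    (hsub : ∀ i j : ℕ, i ≤ j → j < L.length → ¬(i = 0 ∧ j = L.length - 1) →
      φ (QuotientGroup.mk ((((L.drop i).take (j - i + 1)).map
        (Sum.elim (Monoid.Coprod.inl : A →* Monoid.Coprod A B)
          (Monoid.Coprod.inr : B →* Monoid.Coprod A B))).prod)) ≠ 1) :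
    ∃ (ι : Type u) (H : ι → Type u) (instH : ∀ i, Group (H i)),
      haveI := instH
      (∀ i, IsFreeGroup (H i) ∨
        (∃ A' : Subgroup A, Nonempty (H i ≃* A')) ∨
        (∃ B' : Subgroup B, Nonempty (H i ≃* B')) ∨
        Nonempty (H i ≃* Multiplicative (ZMod n))) ∧
      Nonempty (φ.ker ≃* Monoid.CoprodI H) := by
  subst hw
  change (Monoid.Coprod A B ⧸ Subgroup.normalClosure
      {syllableProd (Monoid.Coprod.inl : A →* Monoid.Coprod A B) Monoid.Coprod.inr L ^ n}) →* Q
    at φ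
  let π := QuotientGroup.mk' (Subgroup.normalClosure
      {syllableProd (Monoid.Coprod.inl : A →* Monoid.Coprod A B) Monoid.Coprod.inr L ^ n})
  have hQ' := hQ.subgroup φ.range
  have hφw : φ.rangeRestrict (syllableProd (π.comp Monoid.Coprod.inl)
      (π.comp Monoid.Coprod.inr) L) = 1 := by
    refine hQ'.eq_one_of_pow_eq_one (n := n) (by omega) ?_
    rw [← map_syllableProd, ← map_pow, ← map_pow]
    convert map_one φ.rangeRestrict
    exact (QuotientGroup.eq_one_iff _).mpr (Subgroup.subset_normalClosure rfl)
  have hG := hasCocycles_quotient L n φ.rangeRestrict hφw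
  obtain ⟨VA, ⟨DA⟩⟩ := OrbitSection.exists (φ.rangeRestrict.comp (π.comp Monoid.Coprod.inl))
  obtain ⟨VB, ⟨DB⟩⟩ := OrbitSection.exists (φ.rangeRestrict.comp (π.comp Monoid.Coprod.inr))
  obtain ⟨E, hE⟩ := exists_unique_edge_solutions hQ'
    (φ.rangeRestrict.comp (π.comp Monoid.Coprod.inl))
    (φ.rangeRestrict.comp (π.comp Monoid.Coprod.inr)) DA hlen halt hcyc (by
      intro i j hij hj hn h
      refine hsub i j hij hj hn ?_
      rw [← map_syllableProd, ← map_syllableProd] at h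
      exact congrArg Subtype.val h)
  obtain ⟨ι, H, instH, hH, ⟨f⟩⟩ := hG.exists_mulEquiv_ker φ.rangeRestrict_surjective DA DB hE
  rw [MonoidHom.ker_rangeRestrict] at f
  refine ⟨ι, H, instH, fun i => ?_, ⟨f⟩⟩
  rcases hH i with h | h | h | h
  · exact Or.inl h
  · exact Or.inr (Or.inl ⟨_, h⟩)
  · exact Or.inr (Or.inr (Or.inl ⟨_, h⟩))
  · exact Or.inr (Or.inr (Or.inr h))
end
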